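/- arXiv:2112.13500 — 2 statements merged into one kernel-verified Lean document; each statement's English description precedes it below -/
import Mathlib

section
/- Every maximal finite subgroup of O⁺(3,1)(ℤ) is conjugate in O⁺(3,1)(ℤ) to one of the three subgroups ⟨Ref_{E₁−E₂}, Ref_{E₂−E₃}, Ref_{E₃}⟩, ⟨Ref_{H−E₁−E₂−E₃}, Ref_{E₁−E₂}, Ref_{E₃}⟩, or ⟨Ref_{H−E₁−E₂−E₃}, Ref_{E₁−E₂}, Ref_{E₂−E₃}⟩. -/
open Matrix

/-- The symmetric bilinear form `Q(x,y) = x₀y₀ − x₁y₁ − x₂y₂ − x₃y₃` on `ℤ⁴`. -/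
def Q4 (x y : Fin 4 → ℤ) : ℤ := x 0 * y 0 - x 1 * y 1 - x 2 * y 2 - x 3 * y 3

/-- The Gram matrix `J = diag(1,−1,−1,−1)` of `Q4`. -/
def J4 : Matrix (Fin 4) (Fin 4) ℤ := Matrix.diagonal ![1, -1, -1, -1]

/-- The matrix of the reflection `w ↦ w − (2·Q(v,w)/Q(v,v))·v` about `v`. -/
def reflMat4 (v : Fin 4 → ℤ) : Matrix (Fin 4) (Fin 4) ℤ :=
  Matrix.of fun i j => (if i = j then 1 else 0) - 2 * Q4 v (Pi.single j 1) / Q4 v v * v i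

/-- `Ref_{H−E₁−E₂−E₃}` as an element of `GL(4,ℤ)`. -/
def refHE1E2E3 : (Matrix (Fin 4) (Fin 4) ℤ)ˣ :=
  ⟨reflMat4 ![1, -1, -1, -1], reflMat4 ![1, -1, -1, -1], by decide, by decide⟩

/-- `Ref_{E₁−E₂}` as an element of `GL(4,ℤ)`. -/
def refE1E2' : (Matrix (Fin 4) (Fin 4) ℤ)ˣ :=
  ⟨reflMat4 ![0, 1, -1, 0], reflMat4 ![0, 1, -1, 0], by decide, by decide⟩

/-- `Ref_{E₂−E₃}` as an element of `GL(4,ℤ)`. -/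
def refE2E3 : (Matrix (Fin 4) (Fin 4) ℤ)ˣ :=
  ⟨reflMat4 ![0, 0, 1, -1], reflMat4 ![0, 0, 1, -1], by decide, by decide⟩

/-- `Ref_{E₃}` as an element of `GL(4,ℤ)`. -/
def refE3 : (Matrix (Fin 4) (Fin 4) ℤ)ˣ :=
  ⟨reflMat4 ![0, 0, 0, 1], reflMat4 ![0, 0, 0, 1], by decide, by decide⟩

/-- The set `O⁺(3,1)(ℤ)` of elements of `GL(4,ℤ)` preserving `J` and with positive
`(0,0)` entry. -/
def Oplus31 : Set (Matrix (Fin 4) (Fin 4) ℤ)ˣ :=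
  {A | (A : Matrix (Fin 4) (Fin 4) ℤ)ᵀ * J4 * (A : Matrix (Fin 4) (Fin 4) ℤ) = J4 ∧
    0 < (A : Matrix (Fin 4) (Fin 4) ℤ) 0 0}

/-- Coordinates of the action. -/
lemma mv4 (A : Matrix (Fin 4) (Fin 4) ℤ) (x : Fin 4 → ℤ) (i : Fin 4) :
    (A *ᵥ x) i = A i 0 * x 0 + A i 1 * x 1 + A i 2 * x 2 + A i 3 * x 3 := by
  simp [Matrix.mulVec, dotProduct, Fin.sum_univ_four]

lemma Q4_eq_dot (x y : Fin 4 → ℤ) : Q4 x y = x ⬝ᵥ (J4 *ᵥ y) := by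
  simp [Q4, J4, dotProduct, Fin.sum_univ_four, Matrix.mulVec_diagonal]
  ring

lemma J4_sq : J4 * J4 = 1 := by decide

/-- Isometries preserve the form. -/
lemma Q4_mv {A : Matrix (Fin 4) (Fin 4) ℤ} (hA : Aᵀ * J4 * A = J4) (x y : Fin 4 → ℤ) :
    Q4 (A *ᵥ x) (A *ᵥ y) = Q4 x y := by
  rw [Q4_eq_dot, Q4_eq_dot, Matrix.mulVec_mulVec, ← Matrix.vecMul_transpose,
    ← Matrix.dotProduct_mulVec, Matrix.mulVec_mulVec, ← Matrix.mul_assoc, hA]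

lemma iso_left {A : Matrix (Fin 4) (Fin 4) ℤ} (hA : Aᵀ * J4 * A = J4) :
    (J4 * Aᵀ * J4) * A = 1 := by
  rw [Matrix.mul_assoc J4, Matrix.mul_assoc J4, hA, J4_sq]

lemma iso_right {A : Matrix (Fin 4) (Fin 4) ℤ} (hA : Aᵀ * J4 * A = J4) :
    A * (J4 * Aᵀ * J4) = 1 := mul_eq_one_comm.mp (iso_left hA)

lemma iso_transpose {A : Matrix (Fin 4) (Fin 4) ℤ} (hA : Aᵀ * J4 * A = J4) :
    A * J4 * Aᵀ = J4 := by
  have h := iso_right hA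
  calc A * J4 * Aᵀ = (A * (J4 * Aᵀ * J4)) * J4 := by
        simp only [Matrix.mul_assoc, J4_sq, Matrix.mul_one]
    _ = J4 := by rw [h, Matrix.one_mul]

/-- Column relations, entrywise. -/
lemma col_rel {A : Matrix (Fin 4) (Fin 4) ℤ} (hA : Aᵀ * J4 * A = J4) (i j : Fin 4) :
    A 0 i * A 0 j - A 1 i * A 1 j - A 2 i * A 2 j - A 3 i * A 3 j = J4 i j := by
  rw [← hA]
  simp [J4, Matrix.mul_apply, Fin.sum_univ_four]
  ring

/-- Row relations, entrywise. -/
lemma row_rel {A : Matrix (Fin 4) (Fin 4) ℤ} (hA : Aᵀ * J4 * A = J4) (i j : Fin 4) :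
    A i 0 * A j 0 - A i 1 * A j 1 - A i 2 * A j 2 - A i 3 * A j 3 = J4 i j := by
  have := col_rel (A := Aᵀ) (by simpa using iso_transpose hA) i j
  simpa using this

/-- Future timelike vectors. -/
def Fut (x : Fin 4 → ℤ) : Prop := 0 < Q4 x x ∧ 0 < x 0

lemma cs3 (a b c d e f : ℤ) :
    (a * d + b * e + c * f) ^ 2 ≤ (a ^ 2 + b ^ 2 + c ^ 2) * (d ^ 2 + e ^ 2 + f ^ 2) := by
  nlinarith [sq_nonneg (a * e - b * d), sq_nonneg (a * f - c * d), sq_nonneg (b * f - c * e)]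

/-- Reversed Cauchy-Schwarz. -/
lemma Fut.pair {x y : Fin 4 → ℤ} (hx : Fut x) (hy : Fut y) : 0 < Q4 x y := by
  obtain ⟨h1, h2⟩ := hx
  obtain ⟨h3, h4⟩ := hy
  simp only [Q4] at *
  have h5 : (x 1 * y 1 + x 2 * y 2 + x 3 * y 3) ^ 2 < (x 0 * y 0) ^ 2 := by
    refine lt_of_le_of_lt (cs3 _ _ _ _ _ _) ?_
    rw [mul_pow]
    exact mul_lt_mul'' (by linarith) (by linarith) (by positivity) (by positivity)
  have := abs_lt_of_sq_lt_sq h5 (by positivity)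
  have := (abs_lt.mp this).2
  linarith

lemma Fut.add {x y : Fin 4 → ℤ} (hx : Fut x) (hy : Fut y) : Fut (x + y) := by
  have h := hx.pair hy
  obtain ⟨h1, h2⟩ := hx
  obtain ⟨h3, h4⟩ := hy
  constructor
  · simp only [Q4, Pi.add_apply] at *
    nlinarith
  · simp only [Pi.add_apply]; linarith

lemma Fut.map {A : Matrix (Fin 4) (Fin 4) ℤ} (hA : Aᵀ * J4 * A = J4) (h0 : 0 < A 0 0)
    {x : Fin 4 → ℤ} (hx : Fut x) : Fut (A *ᵥ x) := by
  refine ⟨by rw [Q4_mv hA]; exact hx.1, ?_⟩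
  have hr : Fut ![A 0 0, -A 0 1, -A 0 2, -A 0 3] := by
    refine ⟨?_, by simpa using h0⟩
    have := row_rel hA 0 0
    simp [J4] at this
    simp [Q4]
    linarith
  have := hr.pair hx
  rw [mv4]
  simp [Q4] at this
  linarith

def eH : Fin 4 → ℤ := ![1, 0, 0, 0]

lemma eH_fut : Fut eH := by constructor <;> simp [Q4, eH]

/-- `O⁺(3,1)(ℤ)` as a subgroup. -/
def OS : Subgroup (Matrix (Fin 4) (Fin 4) ℤ)ˣ where
  carrier := Oplus31
  one_mem' := by
    constructor <;> simp
  mul_mem' := by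
    rintro A B ⟨hA, hA0⟩ ⟨hB, hB0⟩
    constructor
    · rw [Units.val_mul, Matrix.transpose_mul]
      calc _ = (B.val)ᵀ * ((A.val)ᵀ * J4 * A.val) * B.val := by simp only [Matrix.mul_assoc]
        _ = _ := by rw [hA, hB]
    · have := (Fut.map hA hA0 (Fut.map hB hB0 eH_fut)).2
      rw [Matrix.mulVec_mulVec, mv4] at this
      simpa [eH] using this
  inv_mem' := by
    rintro A ⟨hA, hA0⟩
    have hi : ((A⁻¹ : (Matrix (Fin 4) (Fin 4) ℤ)ˣ) : Matrix (Fin 4) (Fin 4) ℤ)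
        = J4 * (A.val)ᵀ * J4 := by
      rw [Units.inv_eq_of_mul_eq_one_right (iso_right hA)]
    constructor
    · rw [hi]
      have hJ : J4ᵀ = J4 := by simp [J4]
      simp only [Matrix.transpose_mul, Matrix.transpose_transpose, hJ]
      have h := iso_transpose hA
      calc _ = J4 * A.val * (J4 * J4) * J4 * (A.val)ᵀ * J4 := by
            simp only [Matrix.mul_assoc]
            
        _ = J4 * (A.val * J4 * (A.val)ᵀ) * J4 := by
            simp only [Matrix.mul_assoc, J4_sq, Matrix.one_mul]
        _ = J4 := by rw [h, J4_sq, Matrix.one_mul]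
    · rw [hi]
      simpa [J4, Matrix.mul_diagonal] using hA0

lemma mem_OS {A : (Matrix (Fin 4) (Fin 4) ℤ)ˣ} : A ∈ OS ↔ A ∈ Oplus31 := Iff.rfl

lemma r0_mem : refHE1E2E3 ∈ OS := by constructor <;> decide
lemma r1_mem : refE1E2' ∈ OS := by constructor <;> decide
lemma r2_mem : refE2E3 ∈ OS := by constructor <;> decide
lemma r3_mem : refE3 ∈ OS := by constructor <;> decide

lemma r0_val : refHE1E2E3.val =
    !![2, 1, 1, 1; -1, 0, -1, -1; -1, -1, 0, -1; -1, -1, -1, 0] := by decide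
lemma r1_val : refE1E2'.val = !![1, 0, 0, 0; 0, 0, 1, 0; 0, 1, 0, 0; 0, 0, 0, 1] := by decide
lemma r2_val : refE2E3.val = !![1, 0, 0, 0; 0, 1, 0, 0; 0, 0, 0, 1; 0, 0, 1, 0] := by decide
lemma r3_val : refE3.val = !![1, 0, 0, 0; 0, 1, 0, 0; 0, 0, 1, 0; 0, 0, 0, -1] := by decide

/-- A vector in the interior of the fundamental chamber. -/
def rho : Fin 4 → ℤ := ![7, -3, -2, -1]

lemma rho_fut : Fut rho := by constructor <;> simp [Q4, rho]

/-- The (closed) fundamental chamber. -/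
def Cham (v : Fin 4 → ℤ) : Prop :=
  0 ≤ v 0 + v 1 + v 2 + v 3 ∧ v 1 ≤ v 2 ∧ v 2 ≤ v 3 ∧ v 3 ≤ 0

lemma r0_act (v : Fin 4 → ℤ) : refHE1E2E3.val *ᵥ v =
    ![2 * v 0 + v 1 + v 2 + v 3, -v 0 - v 2 - v 3, -v 0 - v 1 - v 3, -v 0 - v 1 - v 2] := by
  ext i; rw [mv4, r0_val]; fin_cases i <;> simp <;> ring
lemma r1_act (v : Fin 4 → ℤ) : refE1E2'.val *ᵥ v = ![v 0, v 2, v 1, v 3] := by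
  ext i; rw [mv4, r1_val]; fin_cases i <;> simp
lemma r2_act (v : Fin 4 → ℤ) : refE2E3.val *ᵥ v = ![v 0, v 1, v 3, v 2] := by
  ext i; rw [mv4, r2_val]; fin_cases i <;> simp
lemma r3_act (v : Fin 4 → ℤ) : refE3.val *ᵥ v = ![v 0, v 1, v 2, -v 3] := by
  ext i; rw [mv4, r3_val]; fin_cases i <;> simp

/-- Every future vector can be moved into the chamber. -/
lemma exists_cham (n : ℕ) : ∀ v : Fin 4 → ℤ, Fut v → Q4 v rho ≤ n →
    ∃ g ∈ OS, Cham (g.val *ᵥ v) := by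
  induction n with
  | zero =>
    intro v hv h
    have := hv.pair rho_fut
    simp at h
    omega
  | succ n ih =>
    intro v hv h
    have step : ∀ s ∈ OS, Q4 (s.val *ᵥ v) rho < Q4 v rho →
        ∃ g ∈ OS, Cham (g.val *ᵥ v) := by
      intro s hs hlt
      obtain ⟨g, hg, hc⟩ := ih (s.val *ᵥ v) (hv.map hs.1 hs.2) (by push_cast at h; omega)
      refine ⟨g * s, mul_mem hg hs, ?_⟩
      rwa [Units.val_mul, ← Matrix.mulVec_mulVec]
    by_cases h0 : 0 ≤ v 0 + v 1 + v 2 + v 3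
    swap
    · refine step _ r0_mem ?_
      rw [r0_act]; simp [Q4, rho]; omega
    by_cases h1 : v 1 ≤ v 2
    swap
    · refine step _ r1_mem ?_
      rw [r1_act]; simp [Q4, rho]; omega
    by_cases h2 : v 2 ≤ v 3
    swap
    · refine step _ r2_mem ?_
      rw [r2_act]; simp [Q4, rho]; omega
    by_cases h3 : v 3 ≤ 0
    swap
    · refine step _ r3_mem ?_
      rw [r3_act]; simp [Q4, rho]; omega
    exact ⟨1, one_mem _, by simpa using ⟨h0, h1, h2, h3⟩⟩

/-- Norm-one future vectors: `|fᵢ| ≤ f₀ - 1`. -/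
lemma norm_one_bound {a b c d : ℤ} (ha : 0 < a) (h : a ^ 2 - b ^ 2 - c ^ 2 - d ^ 2 = 1) :
    |b| ≤ a - 1 ∧ |c| ≤ a - 1 ∧ |d| ≤ a - 1 := by
  have key : ∀ t : ℤ, t ^ 2 < a ^ 2 → |t| ≤ a - 1 := fun t ht =>
    Int.le_sub_one_of_lt (abs_lt_of_sq_lt_sq ht ha.le)
  refine ⟨key _ ?_, key _ ?_, key _ ?_⟩ <;> nlinarith [sq_nonneg b, sq_nonneg c, sq_nonneg d]

/-- On the chamber, `Q(f, y)` is minimised at `f = H` among norm-one future vectors. -/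
lemma min_at_H {a b c d : ℤ} (ha : 0 < a) (h : a ^ 2 - b ^ 2 - c ^ 2 - d ^ 2 = 1)
    {y : Fin 4 → ℤ} (hy : Cham y) :
    (a - 1) * (y 0 + y 1 + y 2 + y 3) ≤ a * y 0 - b * y 1 - c * y 2 - d * y 3 - y 0 := by
  obtain ⟨hb, hc, hd⟩ := norm_one_bound ha h
  obtain ⟨h0, h1, h2, h3⟩ := hy
  rw [abs_le] at hb hc hd
  nlinarith [mul_nonneg (sub_nonneg.2 hb.1) (by linarith : 0 ≤ - y 1),
    mul_nonneg (sub_nonneg.2 hc.1) (by linarith : 0 ≤ - y 2),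
    mul_nonneg (sub_nonneg.2 hd.1) (by linarith : 0 ≤ - y 3)]

lemma zero_aux {b c d : ℤ} (h : 1 * 1 - b * b - c * c - d * d = 1) :
    b = 0 ∧ c = 0 ∧ d = 0 := by
  have hb := mul_self_nonneg b
  have hc := mul_self_nonneg c
  have hd := mul_self_nonneg d
  exact ⟨mul_self_eq_zero.1 (by linarith), mul_self_eq_zero.1 (by linarith),
    mul_self_eq_zero.1 (by linarith)⟩

lemma unit_row {a b c : ℤ} (h : a * a + b * b + c * c = 1) :
    (a = 1 ∧ b = 0 ∧ c = 0) ∨ (a = -1 ∧ b = 0 ∧ c = 0) ∨ (a = 0 ∧ b = 1 ∧ c = 0) ∨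
    (a = 0 ∧ b = -1 ∧ c = 0) ∨ (a = 0 ∧ b = 0 ∧ c = 1) ∨ (a = 0 ∧ b = 0 ∧ c = -1) := by
  have ha : -1 ≤ a ∧ a ≤ 1 := by constructor <;> nlinarith
  have hb : -1 ≤ b ∧ b ≤ 1 := by constructor <;> nlinarith
  have hc : -1 ≤ c ∧ c ≤ 1 := by constructor <;> nlinarith
  obtain ⟨h1, h2⟩ := ha
  obtain ⟨h3, h4⟩ := hb
  obtain ⟨h5, h6⟩ := hc
  interval_cases a <;> interval_cases b <;> interval_cases c <;> simp_all

/-- The chamber is a strict fundamental domain at interior points. -/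
lemma cham_rigid {A : Matrix (Fin 4) (Fin 4) ℤ} (hA : Aᵀ * J4 * A = J4) (hA0 : 0 < A 0 0)
    {y : Fin 4 → ℤ} (y0 : 0 < y 0 + y 1 + y 2 + y 3) (y1 : y 1 < y 2) (y2 : y 2 < y 3)
    (y3 : y 3 < 0) (hx : Cham (A *ᵥ y)) : A = 1 := by
  have hy : Cham y := ⟨y0.le, y1.le, y2.le, y3.le⟩
  have c00 := col_rel hA 0 0
  have w00 := row_rel hA 0 0
  have w11 := row_rel hA 1 1
  have w22 := row_rel hA 2 2
  have w33 := row_rel hA 3 3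
  have w12 := row_rel hA 1 2
  have w13 := row_rel hA 1 3
  have w23 := row_rel hA 2 3
  simp [J4] at c00 w00 w11 w22 w33 w12 w13 w23
  have hQ := Q4_mv hA eH y
  have m1 := min_at_H (a := A 0 0) (b := A 1 0) (c := A 2 0) (d := A 3 0) hA0 (by linarith) hx
  have m2 := min_at_H (a := A 0 0) (b := -A 0 1) (c := -A 0 2) (d := -A 0 3) hA0 (by linarith) hy
  have e0 := mv4 A y 0
  have e1 := mv4 A y 1
  have e2 := mv4 A y 2
  have e3 := mv4 A y 3
  have hQ' : A 0 0 * (A *ᵥ y) 0 - A 1 0 * (A *ᵥ y) 1 - A 2 0 * (A *ᵥ y) 2 - A 3 0 * (A *ᵥ y) 3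
      = y 0 := by
    have : ∀ i, (A *ᵥ eH) i = A i 0 := fun i => by rw [mv4]; simp [eH]
    simp only [Q4, this] at hQ
    simpa [eH] using hQ
  have m1' : 0 ≤ (A 0 0 - 1) * ((A *ᵥ y) 0 + (A *ᵥ y) 1 + (A *ᵥ y) 2 + (A *ᵥ y) 3) :=
    mul_nonneg (by linarith) hx.1
  have h00 : A 0 0 = 1 := by
    have : (A 0 0 - 1) * (y 0 + y 1 + y 2 + y 3) ≤ 0 := by linarith
    by_contra hne
    have h2 : 0 < A 0 0 - 1 := by omega
    exact absurd (mul_pos h2 y0) (not_lt.2 this)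
  obtain ⟨x0, x1, x2, x3⟩ := hx
  rw [h00] at c00 w00
  obtain ⟨z10, z20, z30⟩ := zero_aux c00
  obtain ⟨z01, z02, z03⟩ := zero_aux w00
  rw [z10] at w11 w12 w13 e1
  rw [z20] at w22 w12 w23 e2
  rw [z30] at w33 w13 w23 e3
  rw [e1, e2] at x1
  rw [e2, e3] at x2
  rw [e3] at x3
  clear hQ hQ' m1 m2 m1' e0 e1 e2 e3 hy hA x0
  have main : (A 1 1 = 1 ∧ A 1 2 = 0 ∧ A 1 3 = 0) ∧ (A 2 1 = 0 ∧ A 2 2 = 1 ∧ A 2 3 = 0) ∧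
      (A 3 1 = 0 ∧ A 3 2 = 0 ∧ A 3 3 = 1) := by
    rcases unit_row (a := A 3 1) (b := A 3 2) (c := A 3 3) (by linarith) with
      ⟨p, q, r⟩ | ⟨p, q, r⟩ | ⟨p, q, r⟩ | ⟨p, q, r⟩ | ⟨p, q, r⟩ | ⟨p, q, r⟩ <;>
    rw [p, q, r] at x2 x3 w13 w23 <;> try (exfalso; linarith)
    all_goals
      rcases unit_row (a := A 2 1) (b := A 2 2) (c := A 2 3) (by linarith) with
        ⟨p', q', r'⟩ | ⟨p', q', r'⟩ | ⟨p', q', r'⟩ | ⟨p', q', r'⟩ | ⟨p', q', r'⟩ | ⟨p', q', r'⟩ <;>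
      rw [p', q', r'] at x2 x1 w12 w23 <;> try (exfalso; linarith)
    all_goals
      rcases unit_row (a := A 1 1) (b := A 1 2) (c := A 1 3) (by linarith) with
        ⟨p'', q'', r''⟩ | ⟨p'', q'', r''⟩ | ⟨p'', q'', r''⟩ | ⟨p'', q'', r''⟩ | ⟨p'', q'', r''⟩ |
        ⟨p'', q'', r''⟩ <;>
      rw [p'', q'', r''] at x1 w12 w13 <;> try (exfalso; linarith)
    all_goals simp [*]
  obtain ⟨⟨a1, a2, a3⟩, ⟨b1, b2, b3⟩, c1, c2, c3⟩ := main
  ext i j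
  fin_cases i <;> fin_cases j <;> simp [*]

/-- The simple reflections fixing `v`. -/
def Tset (v : Fin 4 → ℤ) : Set (Matrix (Fin 4) (Fin 4) ℤ)ˣ :=
  {s | (s = refHE1E2E3 ∧ v 0 + v 1 + v 2 + v 3 = 0) ∨ (s = refE1E2' ∧ v 1 = v 2) ∨
    (s = refE2E3 ∧ v 2 = v 3) ∨ (s = refE3 ∧ v 3 = 0)}

lemma large_aux {N a b : ℤ} (ha : 0 ≤ a) (hb : a = 0 → 0 ≤ b) (hN : |b| ≤ N) :
    0 ≤ N * a + b := by
  rcases ha.eq_or_lt with h | h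
  · subst h; simpa using hb rfl
  · have := neg_abs_le b
    have := abs_nonneg b
    nlinarith

/-- The stabiliser of a chamber vector is generated by the simple reflections fixing it. -/
lemma stab_mem_closure {v : Fin 4 → ℤ} (hc : Cham v) (n : ℕ) :
    ∀ h ∈ OS, h.val *ᵥ v = v → Q4 (h.val *ᵥ rho) rho ≤ n → h ∈ Subgroup.closure (Tset v) := by
  induction n with
  | zero =>
    intro h hO _ hn
    have := (rho_fut.map hO.1 hO.2).pair rho_fut
    simp at hn
    omega
  | succ n ih =>
    intro h hO hv hn
    have step : ∀ s ∈ OS, s ∈ Tset v → s.val *ᵥ v = v →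
        Q4 (s.val *ᵥ (h.val *ᵥ rho)) rho < Q4 (h.val *ᵥ rho) rho →
        h ∈ Subgroup.closure (Tset v) := by
      intro s hs hT hsv hlt
      have h1 := ih (s * h) (mul_mem hs hO)
        (by rw [Units.val_mul, ← Matrix.mulVec_mulVec, hv, hsv])
        (by rw [Units.val_mul, ← Matrix.mulVec_mulVec]; push_cast at hn; omega)
      exact (Subgroup.mul_mem_cancel_left _ (Subgroup.subset_closure hT)).mp h1
    set x := h.val *ᵥ rho with hx
    obtain ⟨c0, c1, c2, c3⟩ := hc
    have d0 : v 0 + v 1 + v 2 + v 3 = 0 → 0 ≤ x 0 + x 1 + x 2 + x 3 ∨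
        h ∈ Subgroup.closure (Tset v) := by
      intro e
      by_contra! hcon
      refine hcon.2 (step _ r0_mem (Or.inl ⟨rfl, e⟩) ?_ ?_)
      · rw [r0_act]; ext i; fin_cases i <;> simp <;> omega
      · rw [r0_act]; simp [Q4, rho]; omega
    have d1 : v 2 - v 1 = 0 → 0 ≤ x 2 - x 1 ∨ h ∈ Subgroup.closure (Tset v) := by
      intro e
      by_contra! hcon
      refine hcon.2 (step _ r1_mem (Or.inr (Or.inl ⟨rfl, by omega⟩)) ?_ ?_)
      · rw [r1_act]; ext i; fin_cases i <;> simp <;> omega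
      · rw [r1_act]; simp [Q4, rho]; omega
    have d2 : v 3 - v 2 = 0 → 0 ≤ x 3 - x 2 ∨ h ∈ Subgroup.closure (Tset v) := by
      intro e
      by_contra! hcon
      refine hcon.2 (step _ r2_mem (Or.inr (Or.inr (Or.inl ⟨rfl, by omega⟩))) ?_ ?_)
      · rw [r2_act]; ext i; fin_cases i <;> simp <;> omega
      · rw [r2_act]; simp [Q4, rho]; omega
    have d3 : - v 3 = 0 → 0 ≤ - x 3 ∨ h ∈ Subgroup.closure (Tset v) := by
      intro e
      by_contra! hcon
      refine hcon.2 (step _ r3_mem (Or.inr (Or.inr (Or.inr ⟨rfl, by omega⟩))) ?_ ?_)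
      · rw [r3_act]; ext i; fin_cases i <;> simp <;> omega
      · rw [r3_act]; simp [Q4, rho]; omega
    by_contra hcl
    simp only [hcl, or_false] at d0 d1 d2 d3
    apply hcl
    have n0 := abs_nonneg (x 0 + x 1 + x 2 + x 3)
    have n1 := abs_nonneg (x 2 - x 1)
    have n2 := abs_nonneg (x 3 - x 2)
    have n3 := abs_nonneg (- x 3)
    obtain ⟨N, hN⟩ : ∃ N : ℤ, N = |x 0 + x 1 + x 2 + x 3| + |x 2 - x 1| + |x 3 - x 2| + |- x 3| :=
      ⟨_, rfl⟩
    have hN0 : 0 ≤ N := by linarith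
    have l0 := large_aux (N := N) c0 d0 (by linarith)
    have l1 := large_aux (N := N) (sub_nonneg.2 c1) d1 (by linarith)
    have l2 := large_aux (N := N) (sub_nonneg.2 c2) d2 (by linarith)
    have l3 := large_aux (N := N) (neg_nonneg.2 c3) d3 (by linarith)
    have hy : h.val *ᵥ (N • v + rho) = N • v + x := by
      rw [Matrix.mulVec_add, Matrix.mulVec_smul, hv]
    have h1 : h.val = 1 := by
      refine cham_rigid hO.1 hO.2 (y := N • v + rho) ?_ ?_ ?_ ?_ ?_
      · simp [rho]; nlinarith
      · simp [rho]; nlinarith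
      · simp [rho]; nlinarith
      · simp [rho]; nlinarith
      · rw [hy]
        refine ⟨?_, ?_, ?_, ?_⟩ <;> simp <;> linarith
    have : h = 1 := Units.ext h1
    rw [this]
    exact one_mem _

lemma bound_aux {a b c d p q r t : ℤ} (ha : 0 < a) (hp : 0 < p)
    (h1 : a * a - b * b - c * c - d * d = 1) (h2 : 1 ≤ p * p - q * q - r * r - t * t)
    (h3 : p = a * p + b * q + c * r + d * t) : a ≤ 2 * p ^ 2 := by
  have cs := cs3 b c d q r t
  have e1 : b * q + c * r + d * t = p - a * p := by linarith
  have e2 : b ^ 2 + c ^ 2 + d ^ 2 = a ^ 2 - 1 := by linarith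
  rw [e1, e2] at cs
  have ha2 : 0 ≤ a ^ 2 - 1 := by rw [← e2]; positivity
  have e3 : (a ^ 2 - 1) * (q ^ 2 + r ^ 2 + t ^ 2) ≤ (a ^ 2 - 1) * (p ^ 2 - 1) :=
    mul_le_mul_of_nonneg_left (by linarith) ha2
  have hp2 : 1 ≤ p ^ 2 := one_le_pow₀ hp
  have e4 : a * a ≤ 2 * p ^ 2 * a := by linarith
  exact le_of_mul_le_mul_right e4 ha

/-- Stabilisers of future vectors are finite. -/
lemma stab_finite {w : Fin 4 → ℤ} (hw : Fut w) :
    {A : (Matrix (Fin 4) (Fin 4) ℤ)ˣ | A ∈ OS ∧ A.val *ᵥ w = w}.Finite := by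
  obtain ⟨C, hC⟩ : ∃ C : ℤ, C = 2 * w 0 ^ 2 := ⟨_, rfl⟩
  have hfin : (Set.univ.pi fun _ : Fin 4 => Set.univ.pi fun _ : Fin 4 =>
      Set.Icc (-(1 + C ^ 2)) (1 + C ^ 2)).Finite :=
    Set.Finite.pi fun _ => Set.Finite.pi fun _ => Set.finite_Icc _ _
  refine Set.Finite.of_injOn (f := fun A : (Matrix (Fin 4) (Fin 4) ℤ)ˣ => fun i j => A.val i j)
    ?_ ?_ hfin
  swap
  · intro A _ B _ hAB
    apply Units.ext
    ext i j
    exact congrFun (congrFun hAB i) j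
  rintro A ⟨⟨hA, hA0⟩, hAw⟩
  obtain ⟨hw1, hw0⟩ := hw
  have c00 := col_rel hA 0 0
  have c11 := col_rel hA 1 1
  have c22 := col_rel hA 2 2
  have c33 := col_rel hA 3 3
  have w00 := row_rel hA 0 0
  simp [J4] at c00 c11 c22 c33 w00
  have e := mv4 A.val w 0
  rw [hAw] at e
  simp only [Q4] at hw1
  have hb : A.val 0 0 ≤ C := by
    rw [hC]
    exact bound_aux hA0 hw0 w00 hw1 e
  have hsq : A.val 0 0 * A.val 0 0 ≤ C ^ 2 := by
    rw [sq]; exact mul_self_le_mul_self hA0.le hb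
  have key : ∀ t : ℤ, t * t ≤ 1 + C ^ 2 → t ∈ Set.Icc (-(1 + C ^ 2)) (1 + C ^ 2) := by
    intro t ht
    have h1 : |t| ≤ t * t := by
      rw [← abs_mul_abs_self]
      rcases (abs_nonneg t).eq_or_lt with h | h
      · rw [← h]; simp
      · nlinarith
    exact abs_le.1 (h1.trans ht)
  intro i _ j _
  apply key
  show A.val i j * A.val i j ≤ 1 + C ^ 2
  generalize hM : A.val = M at *
  fin_cases i <;> fin_cases j <;> simp only [Fin.zero_eta, Fin.mk_one, Fin.reduceFinMk] <;>
  linarith [mul_self_nonneg (M 0 1), mul_self_nonneg (M 0 2), mul_self_nonneg (M 0 3),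
    mul_self_nonneg (M 1 0), mul_self_nonneg (M 1 1), mul_self_nonneg (M 1 2),
    mul_self_nonneg (M 1 3), mul_self_nonneg (M 2 0), mul_self_nonneg (M 2 1),
    mul_self_nonneg (M 2 2), mul_self_nonneg (M 2 3), mul_self_nonneg (M 3 0),
    mul_self_nonneg (M 3 1), mul_self_nonneg (M 3 2), mul_self_nonneg (M 3 3)]

/-- The stabiliser subgroup of `w` in `O⁺`. -/
def Stab (w : Fin 4 → ℤ) : Subgroup (Matrix (Fin 4) (Fin 4) ℤ)ˣ where
  carrier := {A | A ∈ OS ∧ A.val *ᵥ w = w}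
  one_mem' := ⟨one_mem _, by simp⟩
  mul_mem' := by
    rintro A B ⟨hA, hA'⟩ ⟨hB, hB'⟩
    exact ⟨mul_mem hA hB, by rw [Units.val_mul, ← Matrix.mulVec_mulVec, hB', hA']⟩
  inv_mem' := by
    rintro A ⟨hA, hA'⟩
    refine ⟨inv_mem hA, ?_⟩
    conv_lhs => rw [← hA']
    rw [Matrix.mulVec_mulVec, Units.inv_mul, Matrix.one_mulVec]

/-- A finite subgroup of `O⁺` fixes a future vector. -/
lemma exists_fixed (G : Subgroup (Matrix (Fin 4) (Fin 4) ℤ)ˣ) (hG : G ≤ OS)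
    (hfin : (G : Set (Matrix (Fin 4) (Fin 4) ℤ)ˣ).Finite) :
    ∃ v, Fut v ∧ ∀ g ∈ G, g.val *ᵥ v = v := by
  have : Finite G := hfin
  have := Fintype.ofFinite G
  refine ⟨∑ g : G, g.val.val *ᵥ eH, ?_, ?_⟩
  · refine Finset.sum_induction_nonempty _ Fut (fun _ _ h1 h2 => h1.add h2) ⟨1, by simp⟩ ?_
    intro g _
    exact eH_fut.map (hG g.2).1 (hG g.2).2
  · intro g hg
    rw [Matrix.mulVec_sum]
    refine Fintype.sum_equiv (Equiv.mulLeft (⟨g, hg⟩ : G)) _ _ ?_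
    intro k
    simp [Matrix.mulVec_mulVec]

/-- The common end of the argument. -/
lemma finish (G : Subgroup (Matrix (Fin 4) (Fin 4) ℤ)ˣ)
    (hGmax : ∀ G' : Subgroup (Matrix (Fin 4) (Fin 4) ℤ)ˣ,
      (G' : Set (Matrix (Fin 4) (Fin 4) ℤ)ˣ) ⊆ Oplus31 →
      (G' : Set (Matrix (Fin 4) (Fin 4) ℤ)ˣ).Finite → G ≤ G' → G = G')
    {g : (Matrix (Fin 4) (Fin 4) ℤ)ˣ} (hg : g ∈ OS) {S : Set (Matrix (Fin 4) (Fin 4) ℤ)ˣ}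
    {w : Fin 4 → ℤ} (hw : Fut w) (hS : S ⊆ Stab w)
    (hGS : ∀ k ∈ G, g * k * g⁻¹ ∈ Subgroup.closure S) :
    G = Subgroup.map (MulAut.conj g⁻¹).toMonoidHom (Subgroup.closure S) := by
  have hle : Subgroup.closure S ≤ Stab w := (Subgroup.closure_le _).mpr hS
  apply hGmax
  · rintro _ ⟨k, hk, rfl⟩
    have : k ∈ OS := (hle hk).1
    have : g⁻¹ * k * g⁻¹⁻¹ ∈ OS := mul_mem (mul_mem (inv_mem hg) this) (inv_mem (inv_mem hg))
    exact this
  · rw [Subgroup.coe_map]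
    exact Set.Finite.image _ ((stab_finite hw).subset hle)
  · intro k hk
    refine ⟨g * k * g⁻¹, hGS k hk, ?_⟩
    simp [MulAut.conj_apply, mul_assoc]

/-- Every maximal finite subgroup of `O⁺(3,1)(ℤ)` is conjugate in `O⁺(3,1)(ℤ)` to
`⟨Ref_{E₁−E₂}, Ref_{E₂−E₃}, Ref_{E₃}⟩`, `⟨Ref_{H−E₁−E₂−E₃}, Ref_{E₁−E₂}, Ref_{E₃}⟩`, or
`⟨Ref_{H−E₁−E₂−E₃}, Ref_{E₁−E₂}, Ref_{E₂−E₃}⟩`. -/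
theorem max_finite_subgroups_Oplus31 (G : Subgroup (Matrix (Fin 4) (Fin 4) ℤ)ˣ)
    (hGsub : (G : Set (Matrix (Fin 4) (Fin 4) ℤ)ˣ) ⊆ Oplus31)
    (hGfin : (G : Set (Matrix (Fin 4) (Fin 4) ℤ)ˣ).Finite)
    (hGmax : ∀ G' : Subgroup (Matrix (Fin 4) (Fin 4) ℤ)ˣ,
      (G' : Set (Matrix (Fin 4) (Fin 4) ℤ)ˣ) ⊆ Oplus31 →
      (G' : Set (Matrix (Fin 4) (Fin 4) ℤ)ˣ).Finite → G ≤ G' → G = G') :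
    ∃ g ∈ Oplus31,
      G = Subgroup.map (MulAut.conj g).toMonoidHom (Subgroup.closure {refE1E2', refE2E3, refE3}) ∨
      G = Subgroup.map (MulAut.conj g).toMonoidHom
            (Subgroup.closure {refHE1E2E3, refE1E2', refE3}) ∨
      G = Subgroup.map (MulAut.conj g).toMonoidHom
            (Subgroup.closure {refHE1E2E3, refE1E2', refE2E3}) := by
  have hG : G ≤ OS := hGsub
  obtain ⟨v, hv, hfix⟩ := exists_fixed G hG hGfin
  obtain ⟨g, hg, hc⟩ := exists_cham (Q4 v rho).toNat v hv (Int.self_le_toNat _)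
  have hu : Fut (g.val *ᵥ v) := hv.map hg.1 hg.2
  have hcl : ∀ k ∈ G, g * k * g⁻¹ ∈ Subgroup.closure (Tset (g.val *ᵥ v)) := by
    intro k hk
    refine stab_mem_closure hc _ _ (mul_mem (mul_mem hg (hG hk)) (inv_mem hg)) ?_
      (Int.self_le_toNat _)
    rw [Matrix.mulVec_mulVec, ← Units.val_mul, inv_mul_cancel_right, Units.val_mul,
      ← Matrix.mulVec_mulVec, hfix k hk]
  generalize g.val *ᵥ v = u at hc hu hcl
  refine ⟨g⁻¹, OS.inv_mem hg, ?_⟩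
  obtain ⟨c0, c1, c2, c3⟩ := hc
  by_cases t0 : u 0 + u 1 + u 2 + u 3 = 0
  swap
  · left
    refine finish G hGmax hg (w := eH) eH_fut ?_ ?_
    · rintro s (rfl | rfl | rfl)
      · exact ⟨r1_mem, by decide⟩
      · exact ⟨r2_mem, by decide⟩
      · exact ⟨r3_mem, by decide⟩
    · intro k hk
      refine Subgroup.closure_mono ?_ (hcl k hk)
      rintro s (⟨rfl, h⟩ | ⟨rfl, h⟩ | ⟨rfl, h⟩ | ⟨rfl, h⟩) <;> simp_all
  by_cases t2 : u 2 = u 3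
  swap
  · right; left
    refine finish G hGmax hg (w := ![2, -1, -1, 0]) (by constructor <;> decide) ?_ ?_
    · rintro s (rfl | rfl | rfl)
      · exact ⟨r0_mem, by decide⟩
      · exact ⟨r1_mem, by decide⟩
      · exact ⟨r3_mem, by decide⟩
    · intro k hk
      refine Subgroup.closure_mono ?_ (hcl k hk)
      rintro s (⟨rfl, h⟩ | ⟨rfl, h⟩ | ⟨rfl, h⟩ | ⟨rfl, h⟩) <;> simp_all
  by_cases t3 : u 3 = 0
  · exfalso
    have := hu.1
    rw [t3] at t2
    have e : u 0 = - u 1 := by omega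
    simp [Q4, t2, t3, e] at this
  · right; right
    refine finish G hGmax hg (w := ![3, -1, -1, -1]) (by constructor <;> decide) ?_ ?_
    · rintro s (rfl | rfl | rfl)
      · exact ⟨r0_mem, by decide⟩
      · exact ⟨r1_mem, by decide⟩
      · exact ⟨r2_mem, by decide⟩
    · intro k hk
      refine Subgroup.closure_mono ?_ (hcl k hk)
      rintro s (⟨rfl, h⟩ | ⟨rfl, h⟩ | ⟨rfl, h⟩ | ⟨rfl, h⟩) <;> simp_all
end

section
/- Every maximal finite subgroup of O(1,3)(ℤ) is conjugate in O(1,3)(ℤ) to one of the three subgroups ⟨Ref_{E₁−E₂}, Ref_{E₂−E₃}, Ref_{E₃}, −I₄⟩, ⟨Ref_{H−E₁−E₂−E₃}, Ref_{E₁−E₂}, Ref_{E₃}, −I₄⟩, or ⟨Ref_{H−E₁−E₂−E₃}, Ref_{E₁−E₂}, Ref_{E₂−E₃}, −I₄⟩. -/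
open Matrix

/-- The set `O(1,3)(ℤ)` of elements of `GL(4,ℤ)` preserving `J`. -/
def O13 : Set (Matrix (Fin 4) (Fin 4) ℤ)ˣ :=
  {A | (A : Matrix (Fin 4) (Fin 4) ℤ)ᵀ * J4 * (A : Matrix (Fin 4) (Fin 4) ℤ) = J4}

namespace O13Aux

/-- Future timelike vectors. -/
def TL (x : Fin 4 → ℤ) : Prop := 0 < x 0 ∧ 0 < Q4 x x
/-- Future causal vectors. -/
def Fut (x : Fin 4 → ℤ) : Prop := 0 < x 0 ∧ 0 ≤ Q4 x x

theorem TL.fut {x : Fin 4 → ℤ} (h : TL x) : Fut x := ⟨h.1, h.2.le⟩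

theorem Q4_comm (x y : Fin 4 → ℤ) : Q4 x y = Q4 y x := by unfold Q4; ring

theorem Q4_eq (x y : Fin 4 → ℤ) : Q4 x y = x ⬝ᵥ (J4 *ᵥ y) := by
  simp [Q4, J4, dotProduct, Fin.sum_univ_four, mulVec_diagonal]; ring

theorem Q4_act {A : (Matrix (Fin 4) (Fin 4) ℤ)ˣ} (hA : A ∈ O13) (x y : Fin 4 → ℤ) :
    Q4 (A.1 *ᵥ x) (A.1 *ᵥ y) = Q4 x y := by
  have h : A.1ᵀ * J4 * A.1 = J4 := hA
  rw [Q4_eq, Q4_eq]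
  conv_rhs => rw [← h]
  rw [← mulVec_mulVec, ← mulVec_mulVec, dotProduct_mulVec x, vecMul_transpose]

theorem O13_iff (A : (Matrix (Fin 4) (Fin 4) ℤ)ˣ) :
    A ∈ O13 ↔ (A : Matrix (Fin 4) (Fin 4) ℤ)ᵀ * J4 * (A : Matrix (Fin 4) (Fin 4) ℤ) = J4 :=
  Iff.rfl

/-- `O13` as a subgroup. -/
def O13g : Subgroup (Matrix (Fin 4) (Fin 4) ℤ)ˣ where
  carrier := O13
  mul_mem' := by
    intro a b ha hb
    rw [O13_iff] at *
    calc _ = b.1ᵀ * (a.1ᵀ * J4 * a.1) * b.1 := by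
          simp [Matrix.mul_assoc]
      _ = _ := by rw [ha, hb]
  one_mem' := by simp [O13_iff]
  inv_mem' := by
    intro a ha
    rw [O13_iff] at *
    have h1 : a.1 * a⁻¹.1 = 1 := a.mul_inv
    have h2 : a⁻¹.1ᵀ * a.1ᵀ = 1 := by rw [← transpose_mul, h1, transpose_one]
    calc _ = a⁻¹.1ᵀ * (a.1ᵀ * J4 * a.1) * a⁻¹.1 := by rw [ha]
      _ = (a⁻¹.1ᵀ * a.1ᵀ) * J4 * (a.1 * a⁻¹.1) := by simp only [Matrix.mul_assoc]
      _ = _ := by rw [h1, h2]; simp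

theorem mem_O13g {A : (Matrix (Fin 4) (Fin 4) ℤ)ˣ} : A ∈ O13g ↔ A ∈ O13 := Iff.rfl

/-- Spatial Cauchy-Schwarz. -/
theorem cs3 (a b c d e f : ℤ) :
    (a * d + b * e + c * f) ^ 2 ≤ (a ^ 2 + b ^ 2 + c ^ 2) * (d ^ 2 + e ^ 2 + f ^ 2) := by
  nlinarith [sq_nonneg (a * e - b * d), sq_nonneg (a * f - c * d), sq_nonneg (b * f - c * e)]

/-- Reverse Cauchy-Schwarz. -/
theorem rcs {x y : Fin 4 → ℤ} (hx : Fut x) (hy : Fut y) :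
    Q4 x x * Q4 y y ≤ Q4 x y ^ 2 := by
  obtain ⟨hx0, hx⟩ := hx
  obtain ⟨hy0, hy⟩ := hy
  unfold Q4 at *
  have hc := cs3 (x 1) (x 2) (x 3) (y 1) (y 2) (y 3)
  generalize hs : x 1 * y 1 + x 2 * y 2 + x 3 * y 3 = s at hc
  generalize hX : x 1 ^ 2 + x 2 ^ 2 + x 3 ^ 2 = X at hc
  generalize hY : y 1 ^ 2 + y 2 ^ 2 + y 3 ^ 2 = Y at hc
  have e1 : x 0 * x 0 - x 1 * x 1 - x 2 * x 2 - x 3 * x 3 = x 0 ^ 2 - X := by rw [← hX]; ring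
  have e2 : y 0 * y 0 - y 1 * y 1 - y 2 * y 2 - y 3 * y 3 = y 0 ^ 2 - Y := by rw [← hY]; ring
  have e3 : x 0 * y 0 - x 1 * y 1 - x 2 * y 2 - x 3 * y 3 = x 0 * y 0 - s := by rw [← hs]; ring
  rw [e1] at hx ⊢
  rw [e2] at hy ⊢
  rw [e3]
  have hX0 : 0 ≤ X := by rw [← hX]; positivity
  have hY0 : 0 ≤ Y := by rw [← hY]; positivity
  rcases hX0.eq_or_lt with h | h
  · have : s = 0 := by rw [← h] at hc; nlinarith
    subst this; rw [← h]; nlinarith [sq_nonneg (x 0), mul_nonneg (sq_nonneg (x 0)) hY0]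
  · have key : 0 ≤ X * ((x 0 * y 0 - s) ^ 2 - (x 0 ^ 2 - X) * (y 0 ^ 2 - Y)) := by
      nlinarith [sq_nonneg (x 0 * s - y 0 * X), mul_nonneg hx (sub_nonneg.2 hc)]
    have := nonneg_of_mul_nonneg_right key h
    linarith

theorem Q4_pos {x y : Fin 4 → ℤ} (hx : TL x) (hy : Fut y) : 0 < Q4 x y := by
  obtain ⟨hx0, hx⟩ := hx
  obtain ⟨hy0, hy⟩ := hy
  unfold Q4 at *
  have hc := cs3 (x 1) (x 2) (x 3) (y 1) (y 2) (y 3)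
  have h1 : (x 1 * y 1 + x 2 * y 2 + x 3 * y 3) ^ 2 < (x 0 * y 0) ^ 2 := by
    have a1 : x 1 ^ 2 + x 2 ^ 2 + x 3 ^ 2 < x 0 ^ 2 := by linarith
    have a2 : y 1 ^ 2 + y 2 ^ 2 + y 3 ^ 2 ≤ y 0 ^ 2 := by linarith
    have a3 : 0 ≤ x 1 ^ 2 + x 2 ^ 2 + x 3 ^ 2 := by positivity
    have a4 : 0 < y 0 ^ 2 := by positivity
    nlinarith
  have := abs_lt_of_sq_lt_sq h1 (by positivity)
  linarith [le_abs_self (x 1 * y 1 + x 2 * y 2 + x 3 * y 3)]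

theorem Fut_of_pos {x v : Fin 4 → ℤ} (hv : TL v) (hx : 0 ≤ Q4 x x) (h : 0 < Q4 x v) :
    Fut x := by
  refine ⟨?_, hx⟩
  by_contra hn
  rcases (not_lt.1 hn).eq_or_lt with h0 | h0
  · have : x 1 = 0 ∧ x 2 = 0 ∧ x 3 = 0 := by
      unfold Q4 at hx; rw [h0] at hx
      refine ⟨?_, ?_, ?_⟩ <;> nlinarith [sq_nonneg (x 1), sq_nonneg (x 2), sq_nonneg (x 3)]
    unfold Q4 at h; rw [h0, this.1, this.2.1, this.2.2] at h; simp at h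
  · have hf : Fut (-x) := ⟨by simpa using h0, by simpa [Q4] using hx⟩
    have := Q4_pos hv hf
    have e : Q4 v (-x) = - Q4 x v := by simp [Q4]; ring
    omega

theorem perp_zero {x z : Fin 4 → ℤ} (hx : 0 < Q4 x x) (h : Q4 z x = 0) (hz : 0 ≤ Q4 z z) :
    z = 0 := by
  unfold Q4 at *
  have hc := cs3 (z 1) (z 2) (z 3) (x 1) (x 2) (x 3)
  have e : z 1 * x 1 + z 2 * x 2 + z 3 * x 3 = z 0 * x 0 := by linarith
  rw [e] at hc
  have a1 : x 1 ^ 2 + x 2 ^ 2 + x 3 ^ 2 < x 0 ^ 2 := by linarith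
  have a2 : z 1 ^ 2 + z 2 ^ 2 + z 3 ^ 2 ≤ z 0 ^ 2 := by linarith
  have a3 : 0 ≤ x 1 ^ 2 + x 2 ^ 2 + x 3 ^ 2 := by positivity
  have h0 : z 0 = 0 := by
    by_contra hne
    have : 0 < z 0 ^ 2 := by positivity
    nlinarith
  rw [h0] at a2
  ext i
  fin_cases i <;> simp [h0] <;> nlinarith [sq_nonneg (z 1), sq_nonneg (z 2), sq_nonneg (z 3)]

theorem eq_of_le {x y : Fin 4 → ℤ} (hx : TL x) (hy : Fut y) (h : Q4 y y = Q4 x x)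
    (hle : Q4 x y ≤ Q4 x x) : y = x := by
  have h1 := rcs hx.fut hy
  have h2 := Q4_pos hx hy
  have h3 : Q4 x y = Q4 x x := by
    rw [h] at h1
    have := abs_le_of_sq_le_sq (a := Q4 x x) (b := Q4 x y) (by nlinarith) h2.le
    linarith [le_abs_self (Q4 x x)]
  have := perp_zero (x := x) (z := y - x) hx.2
    (by have : Q4 (y - x) x = Q4 x y - Q4 x x := by simp [Q4]; ring
        omega)
    (by have : Q4 (y - x) (y - x) = Q4 y y - 2 * Q4 x y + Q4 x x := by simp [Q4]; ring
        omega)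
  exact sub_eq_zero.1 this

theorem TL_add {x y : Fin 4 → ℤ} (hx : TL x) (hy : TL y) : TL (x + y) := by
  have h := Q4_pos hx hy.fut
  refine ⟨by simpa using add_pos hx.1 hy.1, ?_⟩
  have e : Q4 (x + y) (x + y) = Q4 x x + 2 * Q4 x y + Q4 y y := by simp [Q4]; ring
  have := hx.2; have := hy.2
  omega

/-- Future preserving. -/
def P (A : (Matrix (Fin 4) (Fin 4) ℤ)ˣ) : Prop := ∀ x, Fut x → Fut (A.1 *ᵥ x)

theorem P_of {A : (Matrix (Fin 4) (Fin 4) ℤ)ˣ} (hA : A ∈ O13) {v : Fin 4 → ℤ} (hv : TL v)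
    (h : 0 < (A.1 *ᵥ v) 0) : P A := by
  intro x hx
  refine Fut_of_pos (v := A.1 *ᵥ v) ⟨h, by rw [Q4_act hA]; exact hv.2⟩ ?_ ?_
  · rw [Q4_act hA]; exact hx.2
  · rw [Q4_act hA, Q4_comm]; exact Q4_pos hv hx

theorem inv_act (A : (Matrix (Fin 4) (Fin 4) ℤ)ˣ) (x : Fin 4 → ℤ) :
    A⁻¹.1 *ᵥ (A.1 *ᵥ x) = x := by
  rw [mulVec_mulVec, ← Units.val_mul]; simp

theorem act_inv (A : (Matrix (Fin 4) (Fin 4) ℤ)ˣ) (x : Fin 4 → ℤ) :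
    A.1 *ᵥ (A⁻¹.1 *ᵥ x) = x := by
  rw [mulVec_mulVec, ← Units.val_mul]; simp

def p1 : Fin 4 → ℤ := ![1, 0, 0, 0]
def p2 : Fin 4 → ℤ := ![2, -1, -1, 0]
def p3 : Fin 4 → ℤ := ![3, -1, -1, -1]
def p4 : Fin 4 → ℤ := ![1, -1, 0, 0]
def dl : Fin 4 → ℤ := ![7, -3, -2, -1]

theorem TL1 : TL p1 := by unfold TL; decide
theorem TL2 : TL p2 := by unfold TL; decide
theorem TL3 : TL p3 := by unfold TL; decide
theorem TLd : TL dl := by unfold TL; decide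
theorem F4 : Fut p4 := by unfold Fut; decide

theorem ge_of_sq {x y : Fin 4 → ℤ} (hx : TL x) (hy : Fut y) (k : ℤ) (hk : 0 ≤ k)
    (h : k ^ 2 < Q4 x x * Q4 y y) : k + 1 ≤ Q4 x y := by
  have h1 := rcs hx.fut hy
  have h2 := Q4_pos hx hy
  by_contra hn
  have : Q4 x y ≤ k := by omega
  nlinarith

/-- Pairing with the characteristic vector `p3`. -/
theorem parity (x : Fin 4 → ℤ) (h : Q4 x x = 0) : Even (Q4 p3 x) := by
  have e : Q4 p3 x = 3 * x 0 + x 1 + x 2 + x 3 := by simp [Q4, p3]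
  rw [e]
  have h2 : Even (x 0 * x 0 - x 1 * x 1 - x 2 * x 2 - x 3 * x 3) := by
    unfold Q4 at h; rw [h]; exact Even.zero
  simp only [Int.even_sub, Int.even_add, Int.even_mul] at h2 ⊢
  have : ¬ Even (3 : ℤ) := by decide
  tauto

theorem tab34 {x : Fin 4 → ℤ} (hx : Fut x) (h : Q4 x x = 0) : 2 ≤ Q4 p3 x := by
  have h1 := Q4_pos TL3 hx
  obtain ⟨k, hk⟩ := parity x h
  omega

theorem act_swap {A : (Matrix (Fin 4) (Fin 4) ℤ)ˣ} (hA : A ∈ O13) (x y : Fin 4 → ℤ) :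
    Q4 x (A.1 *ᵥ y) = Q4 y (A⁻¹.1 *ᵥ x) := by
  rw [← Q4_act hA y, act_inv, Q4_comm]

/-- The coefficients with respect to the chamber vertices. -/
def c1 (v : Fin 4 → ℤ) : ℤ := v 0 + v 1 + v 2 + v 3
def c2 (v : Fin 4 → ℤ) : ℤ := v 3 - v 2
def c3 (v : Fin 4 → ℤ) : ℤ := - v 3
def c4 (v : Fin 4 → ℤ) : ℤ := v 2 - v 1

theorem decomp (v : Fin 4 → ℤ) : v = c1 v • p1 + c2 v • p2 + c3 v • p3 + c4 v • p4 := by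
  ext i; fin_cases i <;> simp [c1, c2, c3, c4, p1, p2, p3, p4] <;> ring

theorem Q4_comb (a b c d : ℤ) (x y z w u : Fin 4 → ℤ) :
    Q4 (a • x + b • y + c • z + d • w) u = a * Q4 x u + b * Q4 y u + c * Q4 z u + d * Q4 w u := by
  simp [Q4]; ring

/-- The chamber. -/
def Ch (v : Fin 4 → ℤ) : Prop := 0 ≤ c1 v ∧ 0 ≤ c2 v ∧ 0 ≤ c3 v ∧ 0 ≤ c4 v

theorem row_expand (A : Matrix (Fin 4) (Fin 4) ℤ) (q v : Fin 4 → ℤ) :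
    Q4 q (A *ᵥ v) = c1 v * Q4 q (A *ᵥ p1) + c2 v * Q4 q (A *ᵥ p2) + c3 v * Q4 q (A *ᵥ p3)
      + c4 v * Q4 q (A *ᵥ p4) := by
  conv_lhs => rw [decomp v]
  simp only [mulVec_add, mulVec_smul]
  rw [Q4_comm, Q4_comb]
  simp only [Q4_comm q]

/-- Row inequality: pairing with `q` does not decrease under `A`. -/
def RG (q : Fin 4 → ℤ) (A : (Matrix (Fin 4) (Fin 4) ℤ)ˣ) (v : Fin 4 → ℤ) : Prop :=
    Q4 q v ≤ Q4 q (A.1 *ᵥ v) ∧ c1 v * (Q4 q (A.1 *ᵥ p1) - Q4 q p1) ≤ Q4 q (A.1 *ᵥ v) - Q4 q v ∧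
    c2 v * (Q4 q (A.1 *ᵥ p2) - Q4 q p2) ≤ Q4 q (A.1 *ᵥ v) - Q4 q v ∧
    c3 v * (Q4 q (A.1 *ᵥ p3) - Q4 q p3) ≤ Q4 q (A.1 *ᵥ v) - Q4 q v

theorem row_ge {q : Fin 4 → ℤ} {A : (Matrix (Fin 4) (Fin 4) ℤ)ˣ} {v : Fin 4 → ℤ} (hv : Ch v)
    (h1 : Q4 q p1 ≤ Q4 q (A.1 *ᵥ p1)) (h2 : Q4 q p2 ≤ Q4 q (A.1 *ᵥ p2))
    (h3 : Q4 q p3 ≤ Q4 q (A.1 *ᵥ p3)) (h4 : Q4 q p4 ≤ Q4 q (A.1 *ᵥ p4)) :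
    RG q A v := by
  obtain ⟨a, b, c, d⟩ := hv
  have e := row_expand A.1 q v
  have e' := row_expand 1 q v
  simp only [one_mulVec] at e'
  have k1 := mul_nonneg a (sub_nonneg.2 h1)
  have k2 := mul_nonneg b (sub_nonneg.2 h2)
  have k3 := mul_nonneg c (sub_nonneg.2 h3)
  have k4 := mul_nonneg d (sub_nonneg.2 h4)
  refine ⟨?_, ?_, ?_, ?_⟩ <;> linarith


theorem row1 {A : (Matrix (Fin 4) (Fin 4) ℤ)ˣ} (hA : A ∈ O13) (hP : P A)
    {v : Fin 4 → ℤ} (hv : Ch v) : RG p1 A v := row_ge (q := p1) (A := A) hv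
  (ge_of_sq TL1 (hP _ TL1.fut) 0 (by decide) (by rw [Q4_act hA]; decide))
  (ge_of_sq TL1 (hP _ TL2.fut) 1 (by decide) (by rw [Q4_act hA]; decide))
  (ge_of_sq TL1 (hP _ TL3.fut) 2 (by decide) (by rw [Q4_act hA]; decide))
  (Q4_pos TL1 (hP _ F4))

theorem row2 {A : (Matrix (Fin 4) (Fin 4) ℤ)ˣ} (hA : A ∈ O13) (hP : P A)
    {v : Fin 4 → ℤ} (hv : Ch v) : RG p2 A v := row_ge (q := p2) (A := A) hv
  (ge_of_sq TL2 (hP _ TL1.fut) 1 (by decide) (by rw [Q4_act hA]; decide))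
  (ge_of_sq TL2 (hP _ TL2.fut) 1 (by decide) (by rw [Q4_act hA]; decide))
  (ge_of_sq TL2 (hP _ TL3.fut) 3 (by decide) (by rw [Q4_act hA]; decide))
  (Q4_pos TL2 (hP _ F4))

theorem row3 {A : (Matrix (Fin 4) (Fin 4) ℤ)ˣ} (hA : A ∈ O13) (hP : P A)
    {v : Fin 4 → ℤ} (hv : Ch v) : RG p3 A v := row_ge (q := p3) (A := A) hv
  (ge_of_sq TL3 (hP _ TL1.fut) 2 (by decide) (by rw [Q4_act hA]; decide))
  (ge_of_sq TL3 (hP _ TL2.fut) 3 (by decide) (by rw [Q4_act hA]; decide))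
  (ge_of_sq TL3 (hP _ TL3.fut) 5 (by decide) (by rw [Q4_act hA]; decide))
  (tab34 (hP _ F4) (by rw [Q4_act hA]; decide))

theorem Q4_nonneg {x y : Fin 4 → ℤ} (hx : Fut x) (hy : Fut y) : 0 ≤ Q4 x y := by
  by_contra hn
  have hx' := hx; have hy' := hy
  obtain ⟨hx0, hx⟩ := hx
  obtain ⟨hy0, hy⟩ := hy
  unfold Q4 at *
  have hc := cs3 (x 1) (x 2) (x 3) (y 1) (y 2) (y 3)
  have h1 : (x 1 * y 1 + x 2 * y 2 + x 3 * y 3) ^ 2 ≤ (x 0 * y 0) ^ 2 := by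
    have a1 : x 1 ^ 2 + x 2 ^ 2 + x 3 ^ 2 ≤ x 0 ^ 2 := by linarith
    have a2 : y 1 ^ 2 + y 2 ^ 2 + y 3 ^ 2 ≤ y 0 ^ 2 := by linarith
    have a3 : 0 ≤ x 1 ^ 2 + x 2 ^ 2 + x 3 ^ 2 := by positivity
    have a4 : 0 < y 0 ^ 2 := by positivity
    nlinarith
  have := abs_le_of_sq_le_sq h1 (by positivity)
  linarith [le_abs_self (x 1 * y 1 + x 2 * y 2 + x 3 * y 3)]

theorem row4 {A : (Matrix (Fin 4) (Fin 4) ℤ)ˣ} (hA : A ∈ O13) (hP : P A) (hP' : P A⁻¹)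
    {v : Fin 4 → ℤ} (hv : Ch v) : RG p4 A v := row_ge (q := p4) (A := A) hv
  (by rw [act_swap hA]; exact Q4_pos TL1 (hP' _ F4))
  (by rw [act_swap hA]; exact Q4_pos TL2 (hP' _ F4))
  (by rw [act_swap hA]
      exact tab34 (hP' _ F4) (by rw [Q4_act (O13g.inv_mem hA)]; decide))
  (Q4_nonneg F4 (hP _ F4))

theorem main_eq {A : (Matrix (Fin 4) (Fin 4) ℤ)ˣ} (hA : A ∈ O13) (hP : P A) (hP' : P A⁻¹)
    {v : Fin 4 → ℤ} (hv : Ch v) (hv' : Ch (A.1 *ᵥ v)) (ht : TL v) :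
    A.1 *ᵥ v = v := by
  have hf := hP v ht.fut
  refine eq_of_le ht hf (Q4_act hA _ _) ?_
  rw [Q4_comm, ← Q4_act hA v v]
  have r1 := (row1 hA hP hv).1
  have r2 := (row2 hA hP hv).1
  have r3 := (row3 hA hP hv).1
  have r4 := (row4 hA hP hP' hv).1
  generalize A.1 *ᵥ v = w at *
  obtain ⟨a, b, c, d⟩ := hv'
  have e := decomp w
  have e1 : Q4 w v = c1 w * Q4 p1 v + c2 w * Q4 p2 v + c3 w * Q4 p3 v + c4 w * Q4 p4 v := by
    conv_lhs => rw [e]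
    rw [Q4_comb]
  have e2 : Q4 w w = c1 w * Q4 p1 w + c2 w * Q4 p2 w + c3 w * Q4 p3 w + c4 w * Q4 p4 w := by
    conv_lhs => arg 1; rw [e]
    rw [Q4_comb]
  rw [e1, e2]
  gcongr

theorem main_fix {A : (Matrix (Fin 4) (Fin 4) ℤ)ˣ} (hA : A ∈ O13) (hP : P A) (hP' : P A⁻¹)
    {v : Fin 4 → ℤ} (hv : Ch v) (hfix : A.1 *ᵥ v = v) :
    (0 < c1 v → A.1 *ᵥ p1 = p1) ∧ (0 < c2 v → A.1 *ᵥ p2 = p2) ∧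
      (0 < c3 v → A.1 *ᵥ p3 = p3) := by
  have r1 := (row1 hA hP hv).2.1
  have r2 := (row2 hA hP hv).2.2.1
  have r3 := (row3 hA hP hv).2.2.2
  rw [hfix, sub_self] at r1 r2 r3
  refine ⟨fun h => eq_of_le TL1 (hP _ TL1.fut) (Q4_act hA _ _) ?_,
    fun h => eq_of_le TL2 (hP _ TL2.fut) (Q4_act hA _ _) ?_,
    fun h => eq_of_le TL3 (hP _ TL3.fut) (Q4_act hA _ _) ?_⟩
  · have := nonpos_of_mul_nonpos_right r1 h; linarith
  · have := nonpos_of_mul_nonpos_right r2 h; linarith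
  · have := nonpos_of_mul_nonpos_right r3 h; linarith


theorem actH (v : Fin 4 → ℤ) :
    refHE1E2E3.1 *ᵥ v = ![v 0 + c1 v, v 1 - c1 v, v 2 - c1 v, v 3 - c1 v] := by
  have : refHE1E2E3.1 = !![2, 1, 1, 1; -1, 0, -1, -1; -1, -1, 0, -1; -1, -1, -1, 0] := by decide
  rw [this]
  ext i; fin_cases i <;> simp [mulVec, dotProduct, Fin.sum_univ_four, c1] <;> ring

theorem act12 (v : Fin 4 → ℤ) : refE1E2'.1 *ᵥ v = ![v 0, v 2, v 1, v 3] := by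
  have : refE1E2'.1 = !![1, 0, 0, 0; 0, 0, 1, 0; 0, 1, 0, 0; 0, 0, 0, 1] := by decide
  rw [this]
  ext i; fin_cases i <;> simp [mulVec, dotProduct, Fin.sum_univ_four]

theorem act23 (v : Fin 4 → ℤ) : refE2E3.1 *ᵥ v = ![v 0, v 1, v 3, v 2] := by
  have : refE2E3.1 = !![1, 0, 0, 0; 0, 1, 0, 0; 0, 0, 0, 1; 0, 0, 1, 0] := by decide
  rw [this]
  ext i; fin_cases i <;> simp [mulVec, dotProduct, Fin.sum_univ_four]

theorem act3 (v : Fin 4 → ℤ) : refE3.1 *ᵥ v = ![v 0, v 1, v 2, - v 3] := by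
  have : refE3.1 = !![1, 0, 0, 0; 0, 1, 0, 0; 0, 0, 1, 0; 0, 0, 0, -1] := by decide
  rw [this]
  ext i; fin_cases i <;> simp [mulVec, dotProduct, Fin.sum_univ_four]

theorem memH : refHE1E2E3 ∈ O13 := by rw [O13_iff]; decide
theorem mem12 : refE1E2' ∈ O13 := by rw [O13_iff]; decide
theorem mem23 : refE2E3 ∈ O13 := by rw [O13_iff]; decide
theorem mem3 : refE3 ∈ O13 := by rw [O13_iff]; decide
theorem memN : (-1 : (Matrix (Fin 4) (Fin 4) ℤ)ˣ) ∈ O13 := by rw [O13_iff]; decide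

theorem dH (v : Fin 4 → ℤ) : Q4 dl (refHE1E2E3.1 *ᵥ v) = Q4 dl v + c1 v := by
  rw [actH]; simp [Q4, dl]; ring
theorem d12 (v : Fin 4 → ℤ) : Q4 dl (refE1E2'.1 *ᵥ v) = Q4 dl v + c4 v := by
  rw [act12]; simp [Q4, dl, c4]; ring
theorem d23 (v : Fin 4 → ℤ) : Q4 dl (refE2E3.1 *ᵥ v) = Q4 dl v + c2 v := by
  rw [act23]; simp [Q4, dl, c2]; ring
theorem d3 (v : Fin 4 → ℤ) : Q4 dl (refE3.1 *ᵥ v) = Q4 dl v + 2 * c3 v := by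
  rw [act3]; simp [Q4, dl, c3]; ring

theorem tlH {v : Fin 4 → ℤ} (hv : TL v) : TL (refHE1E2E3.1 *ᵥ v) := by
  refine ⟨?_, by rw [Q4_act memH]; exact hv.2⟩
  have h : 0 < Q4 (![2, -1, -1, -1]) v := Q4_pos (by unfold TL; decide) hv.fut
  rw [actH]
  simp [Q4] at h
  simp [c1]; linarith
theorem tl12 {v : Fin 4 → ℤ} (hv : TL v) : TL (refE1E2'.1 *ᵥ v) :=
  ⟨by rw [act12]; exact hv.1, by rw [Q4_act mem12]; exact hv.2⟩
theorem tl23 {v : Fin 4 → ℤ} (hv : TL v) : TL (refE2E3.1 *ᵥ v) :=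
  ⟨by rw [act23]; exact hv.1, by rw [Q4_act mem23]; exact hv.2⟩
theorem tl3 {v : Fin 4 → ℤ} (hv : TL v) : TL (refE3.1 *ᵥ v) :=
  ⟨by rw [act3]; exact hv.1, by rw [Q4_act mem3]; exact hv.2⟩

/-- Descent: choose an element minimising the pairing with the interior point `dl`. -/
theorem descent (T : Set (Matrix (Fin 4) (Fin 4) ℤ)ˣ) (hT : T.Nonempty) (u : Fin 4 → ℤ)
    (hpos : ∀ M ∈ T, TL (M.1 *ᵥ u)) :
    ∃ M ∈ T, ∀ s, s * M ∈ T → Q4 dl (M.1 *ᵥ u) ≤ Q4 dl (s.1 *ᵥ (M.1 *ᵥ u)) := by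
  obtain ⟨M, hM, hmin⟩ := WellFounded.has_min
    (measure fun M : (Matrix (Fin 4) (Fin 4) ℤ)ˣ => (Q4 dl (M.1 *ᵥ u)).toNat).wf T hT
  refine ⟨M, hM, fun s hs => ?_⟩
  have h1 := hmin _ hs
  have h2 := Q4_pos TLd (hpos _ hs).fut
  have h3 := Q4_pos TLd (hpos _ hM).fut
  simp only [measure, invImage, InvImage, WellFoundedRelation.rel, Units.val_mul,
    ← mulVec_mulVec] at h1 h2
  change ¬ (_ < _) at h1
  omega

theorem to_chamber {v : Fin 4 → ℤ} (hv : TL v) :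
    ∃ g ∈ O13, TL (g.1 *ᵥ v) ∧ Ch (g.1 *ᵥ v) := by
  obtain ⟨M, ⟨hM, ht⟩, hmin⟩ := descent {M | M ∈ O13 ∧ TL (M.1 *ᵥ v)}
    ⟨1, O13g.one_mem, by simpa using hv⟩ v (fun M h => h.2)
  refine ⟨M, hM, ht, ?_⟩
  have k : ∀ s ∈ O13, TL (s.1 *ᵥ (M.1 *ᵥ v)) →
      Q4 dl (M.1 *ᵥ v) ≤ Q4 dl (s.1 *ᵥ (M.1 *ᵥ v)) := by
    intro s hs h
    refine hmin s ⟨O13g.mul_mem hs hM, ?_⟩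
    rw [Units.val_mul, ← mulVec_mulVec]; exact h
  have a := k _ memH (tlH ht)
  have b := k _ mem12 (tl12 ht)
  have c := k _ mem23 (tl23 ht)
  have d := k _ mem3 (tl3 ht)
  rw [dH] at a; rw [d12] at b; rw [d23] at c; rw [d3] at d
  exact ⟨by omega, by omega, by omega, by omega⟩

theorem inv_fix {A : (Matrix (Fin 4) (Fin 4) ℤ)ˣ} {p : Fin 4 → ℤ} (h : A.1 *ᵥ p = p) :
    A⁻¹.1 *ᵥ p = p := by
  conv_lhs => rw [← h]
  exact inv_act A p

theorem eq_one {A : (Matrix (Fin 4) (Fin 4) ℤ)ˣ} (h1 : A.1 *ᵥ p1 = p1) (h2 : A.1 *ᵥ p2 = p2)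
    (h3 : A.1 *ᵥ p3 = p3) (hd : A.1 *ᵥ dl = dl) : A = 1 := by
  have h4 : A.1 *ᵥ p4 = p4 := by
    have : p4 = dl - p1 - p2 - p3 := by decide
    rw [this, mulVec_sub, mulVec_sub, mulVec_sub, h1, h2, h3, hd]
  apply Units.ext
  apply Matrix.ext_of_mulVec_single
  intro i
  rw [decomp (Pi.single i 1)]
  simp only [mulVec_add, mulVec_smul, h1, h2, h3, h4, Units.val_one, one_mulVec]

theorem stab_le {p : Fin 4 → ℤ} (hp : TL p) (hc : Ch p)
    (K : Subgroup (Matrix (Fin 4) (Fin 4) ℤ)ˣ)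
    (h1 : (refHE1E2E3 ∈ K ∧ refHE1E2E3.1 *ᵥ p = p) ∨ 0 < c1 p)
    (h2 : (refE2E3 ∈ K ∧ refE2E3.1 *ᵥ p = p) ∨ 0 < c2 p)
    (h3 : (refE3 ∈ K ∧ refE3.1 *ᵥ p = p) ∨ 0 < c3 p)
    (h4 : (refE1E2' ∈ K ∧ refE1E2'.1 *ᵥ p = p) ∨ 0 < c4 p)
    {B : (Matrix (Fin 4) (Fin 4) ℤ)ˣ} (hB : B ∈ O13) (hBp : B.1 *ᵥ p = p) : B ∈ K := by
  obtain ⟨M, ⟨hM, hMp, hMK⟩, hmin⟩ :=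
    descent {M | M ∈ O13 ∧ M.1 *ᵥ p = p ∧ M * B⁻¹ ∈ K}
    ⟨B, hB, hBp, by simp⟩ dl (by
      rintro M ⟨hM, hMp, -⟩
      have := P_of hM hp (by rw [hMp]; exact hp.1) dl TLd.fut
      exact ⟨this.1, by rw [Q4_act hM]; exact TLd.2⟩)
  have k : ∀ s ∈ O13, s ∈ K ∧ s.1 *ᵥ p = p →
      Q4 dl (M.1 *ᵥ dl) ≤ Q4 dl (s.1 *ᵥ (M.1 *ᵥ dl)) := by
    intro s hs h
    refine hmin s ⟨O13g.mul_mem hs hM, ?_, ?_⟩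
    · rw [Units.val_mul, ← mulVec_mulVec, hMp, h.2]
    · rw [mul_assoc]; exact K.mul_mem h.1 hMK
  have hP : P M := P_of hM hp (by rw [hMp]; exact hp.1)
  have hP' : P M⁻¹ := P_of (O13g.inv_mem hM) hp (by rw [inv_fix hMp]; exact hp.1)
  have g1 := h1.imp_left (k _ memH)
  have g2 := h2.imp_left (k _ mem23)
  have g3 := h3.imp_left (k _ mem3)
  have g4 := h4.imp_left (k _ mem12)
  rw [dH] at g1; rw [d23] at g2; rw [d3] at g3; rw [d12] at g4
  have hMv : ∀ N : ℤ, M.1 *ᵥ (dl + N • p) = M.1 *ᵥ dl + N • p := by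
    intro N; rw [mulVec_add, mulVec_smul, hMp]
  have l1 : ∀ (w : Fin 4 → ℤ) (N : ℤ), c1 (w + N • p) = c1 w + N * c1 p := by
    intro w N; simp [c1]; ring
  have l2 : ∀ (w : Fin 4 → ℤ) (N : ℤ), c2 (w + N • p) = c2 w + N * c2 p := by
    intro w N; simp [c2]; ring
  have l3 : ∀ (w : Fin 4 → ℤ) (N : ℤ), c3 (w + N • p) = c3 w + N * c3 p := by
    intro w N; simp [c3]; ring
  have l4 : ∀ (w : Fin 4 → ℤ) (N : ℤ), c4 (w + N • p) = c4 w + N * c4 p := by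
    intro w N; simp [c4]; ring
  have key : ∀ c d N : ℤ, 0 ≤ d → |c| ≤ N → (0 ≤ c ∨ 0 < d) → 0 ≤ c + N * d := by
    intro c d N hd hN h
    have hN0 : 0 ≤ N := (abs_nonneg c).trans hN
    rcases h with h | h
    · positivity
    · nlinarith [neg_abs_le c]
  obtain ⟨q1, q2, q3, q4⟩ := hc
  obtain ⟨N, n1, n2, n3, n4⟩ : ∃ N : ℤ, |c1 (M.1 *ᵥ dl)| ≤ N ∧ |c2 (M.1 *ᵥ dl)| ≤ N ∧
      |c3 (M.1 *ᵥ dl)| ≤ N ∧ |c4 (M.1 *ᵥ dl)| ≤ N := by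
    have a1 := abs_nonneg (c1 (M.1 *ᵥ dl))
    have a2 := abs_nonneg (c2 (M.1 *ᵥ dl))
    have a3 := abs_nonneg (c3 (M.1 *ᵥ dl))
    have a4 := abs_nonneg (c4 (M.1 *ᵥ dl))
    exact ⟨|c1 (M.1 *ᵥ dl)| + |c2 (M.1 *ᵥ dl)| + |c3 (M.1 *ᵥ dl)| + |c4 (M.1 *ᵥ dl)|,
      by linarith, by linarith, by linarith, by linarith⟩
  have hN0 : 0 ≤ N := (abs_nonneg _).trans n1
  have e1 : c1 dl = 1 := by decide
  have e2 : c2 dl = 1 := by decide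
  have e3 : c3 dl = 1 := by decide
  have e4 : c4 dl = 1 := by decide
  have hch : Ch (dl + N • p) := by
    refine ⟨?_, ?_, ?_, ?_⟩
    · rw [l1, e1]; positivity
    · rw [l2, e2]; positivity
    · rw [l3, e3]; positivity
    · rw [l4, e4]; positivity
  have hch' : Ch (M.1 *ᵥ (dl + N • p)) := by
    rw [hMv]
    refine ⟨?_, ?_, ?_, ?_⟩
    · rw [l1]; exact key _ _ _ q1 n1 (g1.imp_left fun h => by linarith)
    · rw [l2]; exact key _ _ _ q2 n2 (g2.imp_left fun h => by linarith)
    · rw [l3]; exact key _ _ _ q3 n3 (g3.imp_left fun h => by linarith)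
    · rw [l4]; exact key _ _ _ q4 n4 (g4.imp_left fun h => by linarith)
  have htl : TL (dl + N • p) := by
    rcases hN0.eq_or_lt with h | h
    · rw [← h]; simpa using TLd
    · refine TL_add TLd ⟨by simpa using mul_pos h hp.1, ?_⟩
      have : Q4 (N • p) (N • p) = N ^ 2 * Q4 p p := by simp [Q4]; ring
      rw [this]; have := hp.2; positivity
  have hfix := main_eq hM hP hP' hch hch' htl
  rw [hMv] at hfix
  have hd : M.1 *ᵥ dl = dl := add_right_cancel hfix
  have hch0 : Ch dl := by unfold Ch; decide
  obtain ⟨f1, f2, f3⟩ := main_fix hM hP hP' hch0 hd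
  have : M = 1 := eq_one (f1 (by decide)) (f2 (by decide)) (f3 (by decide)) hd
  rw [this, one_mul] at hMK
  exact inv_mem_iff.1 hMK

/-- Elements of `O13` fixing `p` up to sign. -/
def St (p : Fin 4 → ℤ) : Subgroup (Matrix (Fin 4) (Fin 4) ℤ)ˣ where
  carrier := {A | A ∈ O13 ∧ (A.1 *ᵥ p = p ∨ A.1 *ᵥ p = -p)}
  mul_mem' := by
    rintro a b ⟨ha, ha'⟩ ⟨hb, hb'⟩
    refine ⟨O13g.mul_mem ha hb, ?_⟩
    rw [Units.val_mul, ← mulVec_mulVec]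
    rcases ha' with h | h <;> rcases hb' with h' | h' <;> rw [h'] <;> simp [mulVec_neg, h]
  one_mem' := ⟨O13g.one_mem, by simp⟩
  inv_mem' := by
    rintro a ⟨ha, ha'⟩
    refine ⟨O13g.inv_mem ha, ha'.imp inv_fix fun h => ?_⟩
    have := inv_act a p
    rw [h, mulVec_neg] at this
    rw [← this, neg_neg, this]

theorem St_finite {p : Fin 4 → ℤ} (b : ℤ)
    (hb : ∀ x, (∃ j : Fin 4, |Q4 x p| = |Q4 (Pi.single j 1) p|) → -1 ≤ Q4 x x →
      ∀ i, |x i| ≤ b) : (St p : Set (Matrix (Fin 4) (Fin 4) ℤ)ˣ).Finite := by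
  have hfin : (Set.pi Set.univ fun _ : Fin 4 => Set.pi Set.univ fun _ : Fin 4 =>
      Set.Icc (-b) b).Finite := Set.Finite.pi fun _ => Set.Finite.pi fun _ => Set.finite_Icc _ _
  refine Set.Finite.of_finite_image (f := fun A : (Matrix (Fin 4) (Fin 4) ℤ)ˣ =>
    (fun i j => A.1 i j : Fin 4 → Fin 4 → ℤ)) (hfin.subset ?_) ?_
  · rintro _ ⟨A, ⟨hA, hp⟩, rfl⟩
    intro i _ j _
    have h := hb (A.1 *ᵥ Pi.single j 1) ⟨j, ?_⟩ ?_ i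
    · rw [mulVec_single_one] at h
      exact abs_le.1 h
    · rcases hp with hp | hp
      · conv_lhs => rw [← hp]
        rw [Q4_act hA]
      · have : p = -(A.1 *ᵥ p) := by rw [hp, neg_neg]
        conv_lhs => rw [this]
        have e : ∀ x y, Q4 x (-y) = - Q4 x y := by intro x y; simp [Q4]; ring
        rw [e, abs_neg, Q4_act hA]
    · rw [Q4_act hA]; revert j; decide
  · intro A _ B _ h
    apply Units.ext
    exact h

theorem fin1 : (St p1 : Set (Matrix (Fin 4) (Fin 4) ℤ)ˣ).Finite := by
  refine St_finite 20 ?_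
  rintro x ⟨j, hj⟩ hx i
  have h1 : |Q4 x p1| ≤ 3 := by rw [hj]; clear hj; revert j; decide
  rw [abs_le] at h1
  obtain ⟨h1, h2⟩ := h1
  simp [Q4, p1] at h1 h2 hx
  apply abs_le_of_sq_le_sq _ (by norm_num)
  fin_cases i <;> simp <;> nlinarith [sq_nonneg (x 1), sq_nonneg (x 2), sq_nonneg (x 3)]

theorem fin2 : (St p2 : Set (Matrix (Fin 4) (Fin 4) ℤ)ˣ).Finite := by
  refine St_finite 20 ?_
  rintro x ⟨j, hj⟩ hx i
  have h1 : |Q4 x p2| ≤ 3 := by rw [hj]; clear hj; revert j; decide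
  have h2 : Q4 x p2 ^ 2 ≤ 9 := by rw [abs_le] at h1; nlinarith
  have e : Q4 x p2 = 2 * x 0 + x 1 + x 2 := by simp [Q4, p2]; ring
  rw [e] at h2
  simp [Q4] at hx
  apply abs_le_of_sq_le_sq _ (by norm_num)
  fin_cases i <;> simp <;> nlinarith [sq_nonneg (3 * x 0 + 2 * x 1 + 2 * x 2),
    sq_nonneg (x 0 + x 1 + x 2), sq_nonneg (x 0 + x 1), sq_nonneg (x 0 + x 2),
    sq_nonneg (x 1 - x 2), sq_nonneg (x 3), sq_nonneg (3 * x 0 + 4 * x 1), sq_nonneg (3 * x 0 + 4 * x 2)]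

theorem fin3 : (St p3 : Set (Matrix (Fin 4) (Fin 4) ℤ)ˣ).Finite := by
  refine St_finite 20 ?_
  rintro x ⟨j, hj⟩ hx i
  have h1 : |Q4 x p3| ≤ 3 := by rw [hj]; clear hj; revert j; decide
  have h2 : Q4 x p3 ^ 2 ≤ 9 := by rw [abs_le] at h1; nlinarith
  have e : Q4 x p3 = 3 * x 0 + x 1 + x 2 + x 3 := by simp [Q4, p3]; ring
  rw [e] at h2
  simp [Q4] at hx
  apply abs_le_of_sq_le_sq _ (by norm_num)
  fin_cases i <;> simp <;> nlinarith [sq_nonneg (2 * x 0 + x 1 + x 2 + x 3),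
    sq_nonneg (x 0 + x 1), sq_nonneg (x 0 + x 2), sq_nonneg (x 0 + x 3),
    sq_nonneg (x 1 - x 2), sq_nonneg (x 1 - x 3), sq_nonneg (x 2 - x 3),
    sq_nonneg (2 * x 0 + 3 * x 1), sq_nonneg (2 * x 0 + 3 * x 2), sq_nonneg (2 * x 0 + 3 * x 3)]

/-- The orbit vector of a matrix, normalised to be future-pointing. -/
def fv (A : (Matrix (Fin 4) (Fin 4) ℤ)ˣ) : Fin 4 → ℤ :=
  if 0 < (A.1 *ᵥ p1) 0 then A.1 *ᵥ p1 else -(A.1 *ᵥ p1)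

theorem ne0 {x : Fin 4 → ℤ} (h : Q4 x x = 1) : x 0 ≠ 0 := by
  intro h0
  unfold Q4 at h; rw [h0] at h
  nlinarith [sq_nonneg (x 1), sq_nonneg (x 2), sq_nonneg (x 3)]

theorem Qp1 {A : (Matrix (Fin 4) (Fin 4) ℤ)ˣ} (hA : A ∈ O13) :
    Q4 (A.1 *ᵥ p1) (A.1 *ᵥ p1) = 1 := by rw [Q4_act hA]; decide

theorem fv_TL {A : (Matrix (Fin 4) (Fin 4) ℤ)ˣ} (hA : A ∈ O13) : TL (fv A) := by
  have h := Qp1 hA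
  have h0 := ne0 h
  unfold fv
  split_ifs with hc
  · exact ⟨hc, by rw [h]; decide⟩
  · refine ⟨by simp; omega, ?_⟩
    have : Q4 (-(A.1 *ᵥ p1)) (-(A.1 *ᵥ p1)) = 1 := by rw [← h]; simp [Q4]
    rw [this]; decide

theorem fv_or (A : (Matrix (Fin 4) (Fin 4) ℤ)ˣ) : fv A = A.1 *ᵥ p1 ∨ fv A = -(A.1 *ᵥ p1) := by
  unfold fv; split_ifs <;> simp

theorem neg_mem {A : (Matrix (Fin 4) (Fin 4) ℤ)ˣ} (hA : A ∈ O13) : -A ∈ O13 := by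
  rw [← neg_one_mul]; exact O13g.mul_mem memN hA

theorem neg_act (A : (Matrix (Fin 4) (Fin 4) ℤ)ˣ) (x : Fin 4 → ℤ) :
    (-A).1 *ᵥ x = -(A.1 *ᵥ x) := by
  rw [Units.val_neg, neg_mulVec]

theorem fv_eq_of {A : (Matrix (Fin 4) (Fin 4) ℤ)ˣ} {y : Fin 4 → ℤ} (hy : 0 < y 0)
    (h : y = A.1 *ᵥ p1 ∨ y = -(A.1 *ᵥ p1)) : fv A = y := by
  unfold fv
  rcases h with h | h
  · rw [if_pos (by rw [← h]; exact hy), h]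
  · rw [if_neg, h]
    rw [h] at hy; simp at hy; omega

/-- Existence of a sign making the element future preserving. -/
theorem sign_P {h : (Matrix (Fin 4) (Fin 4) ℤ)ˣ} (hh : h ∈ O13) : P h ∨ P (-h) := by
  have := ne0 (Qp1 hh)
  rcases lt_or_gt_of_ne this with h0 | h0
  · right
    exact P_of (neg_mem hh) TL1 (by rw [neg_act]; simpa using h0)
  · left; exact P_of hh TL1 h0

theorem fv_mul {h A : (Matrix (Fin 4) (Fin 4) ℤ)ˣ} (hA : A ∈ O13) (hP : P h) :
    fv (h * A) = h.1 *ᵥ fv A := by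
  apply fv_eq_of (hP _ (fv_TL hA).fut).1
  rw [Units.val_mul, ← mulVec_mulVec]
  rcases fv_or A with e | e <;> rw [e]
  · left; rfl
  · right; rw [mulVec_neg]

theorem fv_neg_mul {h A : (Matrix (Fin 4) (Fin 4) ℤ)ˣ} (hA : A ∈ O13) (hh : h ∈ O13)
    (hP : P (-h)) :
    fv (h * A) = -(h.1 *ᵥ fv A) := by
  rw [← neg_act, ← fv_mul hA hP]
  have : -h * A = -(h * A) := neg_mul h A
  rw [this]
  apply fv_eq_of (fv_TL ?_).1
  · rcases fv_or (-(h * A)) with e | e <;> rw [e, neg_act]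
    · right; rfl
    · left; simp
  · exact neg_mem (O13g.mul_mem hh hA)

theorem exists_fixed (G : Subgroup (Matrix (Fin 4) (Fin 4) ℤ)ˣ)
    (hGsub : (G : Set (Matrix (Fin 4) (Fin 4) ℤ)ˣ) ⊆ O13)
    (hGfin : (G : Set (Matrix (Fin 4) (Fin 4) ℤ)ˣ).Finite) :
    ∃ v, TL v ∧ ∀ A ∈ G, A.1 *ᵥ v = v ∨ A.1 *ᵥ v = -v := by
  have : Fintype G := hGfin.fintype
  refine ⟨∑ A : G, fv A.1, ?_, ?_⟩
  · exact Finset.sum_induction_nonempty _ TL (fun _ _ => TL_add) Finset.univ_nonempty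
      (fun A _ => fv_TL (hGsub A.2))
  · intro h hh
    have e : ∑ A : G, fv ((⟨h, hh⟩ * A : G) : (Matrix (Fin 4) (Fin 4) ℤ)ˣ) = ∑ A : G, fv A.1 :=
      Equiv.sum_comp (Equiv.mulLeft (⟨h, hh⟩ : G)) (fun A : G => fv A.1)
    rcases sign_P (hGsub hh) with hP | hP
    · left
      rw [mulVec_sum]
      conv_rhs => rw [← e]
      exact Finset.sum_congr rfl fun A _ => (fv_mul (hGsub A.2) hP).symm
    · right
      rw [mulVec_sum]
      conv_rhs => rw [← e]
      rw [← Finset.sum_neg_distrib]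
      refine Finset.sum_congr rfl fun A _ => ?_
      rw [Subgroup.coe_mul, fv_neg_mul (hGsub A.2) (hGsub hh) hP, neg_neg]

theorem finish (G : Subgroup (Matrix (Fin 4) (Fin 4) ℤ)ˣ)
    (hGsub : (G : Set (Matrix (Fin 4) (Fin 4) ℤ)ˣ) ⊆ O13)
    (hGmax : ∀ G' : Subgroup (Matrix (Fin 4) (Fin 4) ℤ)ˣ,
      (G' : Set (Matrix (Fin 4) (Fin 4) ℤ)ˣ) ⊆ O13 →
      (G' : Set (Matrix (Fin 4) (Fin 4) ℤ)ˣ).Finite → G ≤ G' → G = G')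
    {p : Fin 4 → ℤ} (hfin : (St p : Set (Matrix (Fin 4) (Fin 4) ℤ)ˣ).Finite)
    (K : Subgroup (Matrix (Fin 4) (Fin 4) ℤ)ˣ) (hK : K ≤ St p) (hN : -1 ∈ K)
    (hstab : ∀ B ∈ O13, B.1 *ᵥ p = p → B ∈ K)
    {g : (Matrix (Fin 4) (Fin 4) ℤ)ˣ} (hg : g ∈ O13) {v : Fin 4 → ℤ} (hv : TL (g.1 *ᵥ v))
    (hGv : ∀ A ∈ G, A.1 *ᵥ v = v ∨ A.1 *ᵥ v = -v)
    (hfix : ∀ B ∈ O13, P B → P B⁻¹ → B.1 *ᵥ (g.1 *ᵥ v) = g.1 *ᵥ v → B.1 *ᵥ p = p) :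
    G = Subgroup.map (MulAut.conj g⁻¹).toMonoidHom K := by
  have hstab' : ∀ B ∈ O13, B.1 *ᵥ (g.1 *ᵥ v) = g.1 *ᵥ v → B ∈ K := by
    intro B hB h
    refine hstab B hB (hfix B hB (P_of hB hv (by rw [h]; exact hv.1))
      (P_of (O13g.inv_mem hB) hv (by rw [inv_fix h]; exact hv.1)) h)
  apply hGmax
  · rintro _ ⟨k, hk, rfl⟩
    exact O13g.mul_mem (O13g.mul_mem (O13g.inv_mem hg) (hK hk).1) (O13g.inv_mem (O13g.inv_mem hg))
  · exact (hfin.subset hK).image _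
  · intro A hA
    have hgA : g * A * g⁻¹ ∈ O13 := O13g.mul_mem (O13g.mul_mem hg (hGsub hA)) (O13g.inv_mem hg)
    have hact : (g * A * g⁻¹).1 *ᵥ (g.1 *ᵥ v) = g.1 *ᵥ (A.1 *ᵥ v) := by
      rw [Units.val_mul, Units.val_mul, ← mulVec_mulVec, ← mulVec_mulVec, inv_act]
    refine ⟨g * A * g⁻¹, ?_, by simp [MulAut.conj_apply, mul_assoc]⟩
    rcases hGv A hA with h | h
    · exact hstab' _ hgA (by rw [hact, h])
    · have := hstab' _ (neg_mem hgA) (by rw [neg_act, hact, h, mulVec_neg, neg_neg])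
      have h2 := K.mul_mem hN this
      simpa using h2

end O13Aux

open O13Aux in
/-- Every maximal finite subgroup of `O(1,3)(ℤ)` is conjugate in `O(1,3)(ℤ)` to
`⟨Ref_{E₁−E₂}, Ref_{E₂−E₃}, Ref_{E₃}, −I₄⟩`, `⟨Ref_{H−E₁−E₂−E₃}, Ref_{E₁−E₂}, Ref_{E₃}, −I₄⟩`,
or `⟨Ref_{H−E₁−E₂−E₃}, Ref_{E₁−E₂}, Ref_{E₂−E₃}, −I₄⟩`. -/
theorem max_finite_subgroups_O13 (G : Subgroup (Matrix (Fin 4) (Fin 4) ℤ)ˣ)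
    (hGsub : (G : Set (Matrix (Fin 4) (Fin 4) ℤ)ˣ) ⊆ O13)
    (hGfin : (G : Set (Matrix (Fin 4) (Fin 4) ℤ)ˣ).Finite)
    (hGmax : ∀ G' : Subgroup (Matrix (Fin 4) (Fin 4) ℤ)ˣ,
      (G' : Set (Matrix (Fin 4) (Fin 4) ℤ)ˣ) ⊆ O13 →
      (G' : Set (Matrix (Fin 4) (Fin 4) ℤ)ˣ).Finite → G ≤ G' → G = G') :
    ∃ g ∈ O13,
      G = Subgroup.map (MulAut.conj g).toMonoidHom
            (Subgroup.closure {refE1E2', refE2E3, refE3, -1}) ∨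
      G = Subgroup.map (MulAut.conj g).toMonoidHom
            (Subgroup.closure {refHE1E2E3, refE1E2', refE3, -1}) ∨
      G = Subgroup.map (MulAut.conj g).toMonoidHom
            (Subgroup.closure {refHE1E2E3, refE1E2', refE2E3, -1}) := by
  obtain ⟨v, hv, hGv⟩ := exists_fixed G hGsub hGfin
  obtain ⟨g, hg, hgv, hch⟩ := to_chamber hv
  refine ⟨g⁻¹, O13g.inv_mem hg, ?_⟩
  by_cases h1 : 0 < c1 (g.1 *ᵥ v)
  · left
    have m : ∀ s ∈ ({refE1E2', refE2E3, refE3, -1} : Set (Matrix (Fin 4) (Fin 4) ℤ)ˣ),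
        s ∈ Subgroup.closure {refE1E2', refE2E3, refE3, -1} := fun s hs =>
      Subgroup.subset_closure hs
    refine finish G hGsub hGmax fin1 _ ?_ (m _ (by simp)) ?_ hg hgv hGv
      (fun B hB hP hP' hf => (main_fix hB hP hP' hch hf).1 h1)
    · rw [Subgroup.closure_le]
      rintro s (rfl | rfl | rfl | rfl)
      · exact ⟨mem12, by decide⟩
      · exact ⟨mem23, by decide⟩
      · exact ⟨mem3, by decide⟩
      · exact ⟨memN, by decide⟩
    · intro B hB hBp
      exact stab_le TL1 (by unfold Ch; decide) _ (Or.inr (by decide))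
        (Or.inl ⟨m _ (by simp), by decide⟩) (Or.inl ⟨m _ (by simp), by decide⟩)
        (Or.inl ⟨m _ (by simp), by decide⟩) hB hBp
  by_cases h2 : 0 < c2 (g.1 *ᵥ v)
  · right; left
    have m : ∀ s ∈ ({refHE1E2E3, refE1E2', refE3, -1} : Set (Matrix (Fin 4) (Fin 4) ℤ)ˣ),
        s ∈ Subgroup.closure {refHE1E2E3, refE1E2', refE3, -1} := fun s hs =>
      Subgroup.subset_closure hs
    refine finish G hGsub hGmax fin2 _ ?_ (m _ (by simp)) ?_ hg hgv hGv
      (fun B hB hP hP' hf => (main_fix hB hP hP' hch hf).2.1 h2)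
    · rw [Subgroup.closure_le]
      rintro s (rfl | rfl | rfl | rfl)
      · exact ⟨memH, by decide⟩
      · exact ⟨mem12, by decide⟩
      · exact ⟨mem3, by decide⟩
      · exact ⟨memN, by decide⟩
    · intro B hB hBp
      exact stab_le TL2 (by unfold Ch; decide) _ (Or.inl ⟨m _ (by simp), by decide⟩)
        (Or.inr (by decide)) (Or.inl ⟨m _ (by simp), by decide⟩)
        (Or.inl ⟨m _ (by simp), by decide⟩) hB hBp
  by_cases h3 : 0 < c3 (g.1 *ᵥ v)
  · right; right
    have m : ∀ s ∈ ({refHE1E2E3, refE1E2', refE2E3, -1} : Set (Matrix (Fin 4) (Fin 4) ℤ)ˣ),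
        s ∈ Subgroup.closure {refHE1E2E3, refE1E2', refE2E3, -1} := fun s hs =>
      Subgroup.subset_closure hs
    refine finish G hGsub hGmax fin3 _ ?_ (m _ (by simp)) ?_ hg hgv hGv
      (fun B hB hP hP' hf => (main_fix hB hP hP' hch hf).2.2 h3)
    · rw [Subgroup.closure_le]
      rintro s (rfl | rfl | rfl | rfl)
      · exact ⟨memH, by decide⟩
      · exact ⟨mem12, by decide⟩
      · exact ⟨mem23, by decide⟩
      · exact ⟨memN, by decide⟩
    · intro B hB hBp
      exact stab_le TL3 (by unfold Ch; decide) _ (Or.inl ⟨m _ (by simp), by decide⟩)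
        (Or.inl ⟨m _ (by simp), by decide⟩) (Or.inr (by decide))
        (Or.inl ⟨m _ (by simp), by decide⟩) hB hBp
  exfalso
  obtain ⟨a, b, c, d⟩ := hch
  have ht := hgv.2
  generalize g.1 *ᵥ v = w at *
  have w3 : w 3 = 0 := by simp only [c3] at *; omega
  have w2 : w 2 = 0 := by simp only [c2] at *; omega
  have w1 : w 1 = - w 0 := by simp only [c1] at *; omega
  simp [Q4, w3, w2, w1] at ht
end
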